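/- Let γ ∈ [0,1), let K be a coagulation kernel satisfying the standing assumptions, let ρ ∈ (γ,1) and β = 1/(ρ−γ). Then there exists a nonnegative continuous function h on (0,∞), locally integrable near 0, with ∫_0^R h(x)dx ≤ R^{1−ρ} for all R > 0, such that for every test function ψ ∈ C_c^1([0,∞)) one has ∫_0^∞ ψ'(x) (∫_0^x ∫_{x−y}^∞ (K(y,z)/z) h(z) h(y) dz dy) dx − β ∫_0^∞ (x ψ(x))' h(x) dx + βρ ∫_0^∞ ψ(x) h(x) dx = 0, and moreover h(x)/((1−ρ) x^{−ρ}) → 1 as x → ∞. -/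

import Mathlib

open MeasureTheory Real Set Filter Topology

noncomputable section

namespace Smol

/-- Standing assumptions on the coagulation kernel `K`: continuity on `(0,∞)²`, symmetry,
nonnegativity, homogeneity of degree `γ` and the growth bound `K(x,y) ≤ C(x^γ + y^γ)`. -/
structure KernelHyp (K : ℝ → ℝ → ℝ) (γ C : ℝ) : Prop where
  cont : ContinuousOn (fun p : ℝ × ℝ => K p.1 p.2) (Ioi (0:ℝ) ×ˢ Ioi (0:ℝ))
  symm : ∀ x y : ℝ, 0 < x → 0 < y → K x y = K y x
  nonneg : ∀ x y : ℝ, 0 < x → 0 < y → 0 ≤ K x y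
  homog : ∀ a x y : ℝ, 0 < a → 0 < x → 0 < y → K (a * x) (a * y) = a ^ γ * K x y
  growth : ∀ x y : ℝ, 0 < x → 0 < y → K x y ≤ C * (x ^ γ + y ^ γ)

/-- `I[h](x) = ∫_0^x ∫_{x-y}^∞ (K(y,z)/z) h(z) h(y) dz dy` for a density `h`. -/
def Ifun (K : ℝ → ℝ → ℝ) (h : ℝ → ℝ) (x : ℝ) : ℝ :=
  ∫ y in Ioc (0:ℝ) x, (∫ z in Ioi (x - y), K y z / z * h z) * h y

section Brouwer

variable {E : Type*} [NormedAddCommGroup E] [InnerProductSpace ℝ E]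

/-- The metric projection onto a nonempty closed convex subset of a Hilbert space. -/
theorem exists_metric_projection [CompleteSpace E] {S : Set E} (hne : S.Nonempty)
    (hcl : IsClosed S) (hconv : Convex ℝ S) :
    ∃ P : E → E, LipschitzWith 1 P ∧ (∀ x, P x ∈ S) ∧ (∀ x ∈ S, P x = x) ∧
      ∀ x, ∀ w ∈ S, inner ℝ (x - P x) (w - P x) ≤ 0 := by
  choose P hPS hPn using exists_norm_eq_iInf_of_complete_convex hne hcl.isComplete hconv
  have hin : ∀ x, ∀ w ∈ S, inner ℝ (x - P x) (w - P x) ≤ 0 := fun x =>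
    (norm_eq_iInf_iff_real_inner_le_zero hconv (hPS x)).1 (hPn x)
  refine ⟨P, ?_, hPS, ?_, hin⟩
  · refine LipschitzWith.of_dist_le_mul fun x y => ?_
    rw [NNReal.coe_one, one_mul, dist_eq_norm, dist_eq_norm]
    have h1 := hin x (P y) (hPS y)
    have h2 := hin y (P x) (hPS x)
    have key : ‖P x - P y‖ ^ 2 ≤ inner ℝ (x - y) (P x - P y) := by
      have e1 : inner ℝ (x - P x) (P y - P x) = - inner ℝ (x - P x) (P x - P y) := by
        rw [← inner_neg_right]; congr 1; abel
      have e2 : inner ℝ (x - y) (P x - P y)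
          = inner ℝ (x - P x) (P x - P y) - inner ℝ (y - P y) (P x - P y)
            + inner ℝ (P x - P y) (P x - P y) := by
        rw [← inner_sub_left, ← inner_add_left]; congr 1; abel
      rw [real_inner_self_eq_norm_sq] at e2
      linarith
    have h3 := real_inner_le_norm (x - y) (P x - P y)
    by_contra hlt
    push Not at hlt
    nlinarith [norm_nonneg (x - y), norm_nonneg (P x - P y)]
  · intro x hx
    have h := hin x x hx
    rw [real_inner_self_eq_norm_sq] at h
    have : ‖x - P x‖ = 0 := by nlinarith [norm_nonneg (x - P x)]
    rw [norm_eq_zero, sub_eq_zero] at this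
    exact this.symm

variable [FiniteDimensional ℝ E]

theorem exists_det_interpolation (t : ℕ → ℝ) (ht : Function.Injective t) :
    ∃ c : ℕ → ℝ, ∀ A : E →L[ℝ] E, (1 + A).det
      = ∑ i ∈ Finset.range (Module.finrank ℝ E + 1), c i * (1 + t i • A).det := by
  classical
  set s := Finset.range (Module.finrank ℝ E + 1)
  refine ⟨fun i => (Lagrange.basis s t i).eval 1, fun A => ?_⟩
  let b := Module.finBasis ℝ E
  let M := LinearMap.toMatrix b b (A : E →ₗ[ℝ] E)
  let p : Polynomial ℝ := Matrix.det ((Polynomial.X : Polynomial ℝ) • M.map Polynomial.C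
    + (1 : Matrix _ _ ℝ).map Polynomial.C)
  have hp : ∀ r : ℝ, p.eval r = (1 + r • A).det := by
    intro r
    have h1 : (1 + r • A).det = Matrix.det (1 + r • M) := by
      rw [ContinuousLinearMap.det, ← LinearMap.det_toMatrix b]
      congr 1
      simp [M, map_add, ContinuousLinearMap.one_def]
    rw [h1, ← Polynomial.coe_evalRingHom, RingHom.map_det]
    congr 1
    ext i j
    by_cases hij : i = j <;> simp [hij] <;> ring
  have hdeg : p.degree < s.card := by
    refine Polynomial.degree_le_natDegree.trans_lt ?_
    have := Polynomial.natDegree_det_X_add_C_le M 1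
    simp only [s, Finset.card_range]
    rw [Fintype.card_fin] at this
    exact_mod_cast Nat.lt_succ_of_le this
  have h := Lagrange.eq_interpolate (v := t) (s := s) ht.injOn hdeg
  have h1 : p.eval 1 = (1 + A).det := by rw [hp, one_smul]
  rw [← h1]
  conv_lhs => rw [h]
  rw [Lagrange.interpolate_apply, Polynomial.eval_finsetSum]
  refine Finset.sum_congr rfl fun i _ => ?_
  simp [hp, mul_comm]

theorem det_one_add_pos {A : E →L[ℝ] E} (hA : ‖A‖ < 1) : 0 < (1 + A).det := by
  have hne : ∀ s ∈ Icc (0:ℝ) 1, (1 + s • A).det ≠ 0 := by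
    intro s hs
    have hn : ‖-(s • A)‖ < 1 := by
      rw [norm_neg, norm_smul, Real.norm_eq_abs, abs_of_nonneg hs.1]
      nlinarith [hs.2, norm_nonneg A]
    have hu : IsUnit (1 + s • A) := by
      have := isUnit_one_sub_of_norm_lt_one hn
      simpa using this
    have h2 : IsUnit (((1 + s • A : E →L[ℝ] E) : E →ₗ[ℝ] E)) :=
      hu.map (ContinuousLinearMap.toLinearMapRingHom : (E →L[ℝ] E) →+* (E →ₗ[ℝ] E))
    exact (LinearMap.isUnit_iff_isUnit_det _).1 h2 |>.ne_zero
  have hcont : Continuous fun s : ℝ => (1 + s • A).det :=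
    ContinuousLinearMap.continuous_det.comp (by fun_prop)
  by_contra hle
  push Not at hle
  have h0 : (1 + (0:ℝ) • A).det = 1 := by simp [ContinuousLinearMap.det]
  have h1 : (1 + (1:ℝ) • A).det ≤ 0 := by simpa using hle
  obtain ⟨s, hs, hs0⟩ := intermediate_value_Icc' (zero_le_one' ℝ) hcont.continuousOn
    (show (0:ℝ) ∈ Icc _ _ from ⟨h1, by rw [h0]; norm_num⟩)
  exact hne s hs hs0


theorem not_exists_smooth_retraction [MeasurableSpace E] [BorelSpace E] [Nontrivial E] {r : E → E}
    (hr : ∀ x ∈ Metric.closedBall (0:E) 1, ContDiffAt ℝ 1 r x)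
    (hr1 : ∀ x ∈ Metric.closedBall (0:E) 1, ‖r x‖ = 1)
    (hrs : ∀ x : E, ‖x‖ = 1 → r x = x) : False := by
  set B := Metric.closedBall (0:E) 1 with hB
  set U := Metric.ball (0:E) 1 with hU
  have hUB : U ⊆ B := Metric.ball_subset_closedBall
  have hBc : IsCompact B := isCompact_closedBall 0 1
  set v : E → E := fun x => r x - x with hv
  have hvC : ∀ x ∈ B, ContDiffAt ℝ 1 v x := fun x hx => (hr x hx).sub contDiffAt_id
  have hvd : ∀ x ∈ B, DifferentiableAt ℝ v x := fun x hx => (hvC x hx).differentiableAt (by simp)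
  have hDc : ContinuousOn (fderiv ℝ v) B := fun x hx =>
    ((hvC x hx).continuousAt_fderiv (by simp)).continuousWithinAt
  obtain ⟨L0, hL0⟩ := (hBc.image_of_continuousOn hDc).isBounded.exists_norm_le
  set L : ℝ := max L0 1 with hL
  have hLpos : 0 < L := lt_of_lt_of_le one_pos (le_max_right _ _)
  have hLb : ∀ x ∈ B, ‖fderiv ℝ v x‖ ≤ L := fun x hx =>
    (hL0 _ (mem_image_of_mem _ hx)).trans (le_max_left _ _)
  have hLip : ∀ x ∈ B, ∀ y ∈ B, ‖v x - v y‖ ≤ L * ‖x - y‖ := fun x hx y hy =>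
    (convex_closedBall (0:E) 1).norm_image_sub_le_of_norm_fderiv_le hvd hLb hy hx
  obtain ⟨P, hP1, hPB, hPid, hPin⟩ := exists_metric_projection (S := B)
    ⟨0, by simp [hB]⟩ Metric.isClosed_closedBall (convex_closedBall 0 1)
  have hPs : ∀ x, 1 ≤ ‖x‖ → ‖P x‖ = 1 := by
    intro x hx
    have hle : ‖P x‖ ≤ 1 := by simpa [hB] using hPB x
    by_contra hne
    have hlt : ‖P x‖ < 1 := lt_of_le_of_ne hle hne
    have hxP : x ≠ P x := by
      intro h; rw [← h] at hlt; linarith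
    have hpos : 0 < ‖x - P x‖ := norm_pos_iff.2 (sub_ne_zero.2 hxP)
    set s := (1 - ‖P x‖) / ‖x - P x‖ with hs
    have hspos : 0 < s := div_pos (by linarith) hpos
    have hw : P x + s • (x - P x) ∈ B := by
      rw [hB, mem_closedBall_zero_iff]
      refine (norm_add_le _ _).trans ?_
      rw [norm_smul, Real.norm_eq_abs, abs_of_pos hspos, hs, div_mul_cancel₀ _ hpos.ne']
      linarith
    have := hPin x _ hw
    rw [add_sub_cancel_left, inner_smul_right, real_inner_self_eq_norm_sq] at this
    have : 0 < s * ‖x - P x‖ ^ 2 := by positivity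
    linarith
  have hvs : ∀ x : E, ‖x‖ = 1 → v x = 0 := fun x hx => by simp [hv, hrs x hx]
  have hvol : ∀ t : ℝ, 0 < t → t * L < 1 → ∫ x in U, (1 + t • fderiv ℝ v x).det
      = ∫ x in U, (1:ℝ) := by
    intro t ht htL
    have ht1 : t < 1 := by nlinarith [le_max_right L0 1]
    set g : E → E := fun x => x + t • v x with hg
    have hinj : InjOn g U := by
      intro x hx y hy hxy
      have h1 : x - y = - (t • (v x - v y)) := by
        simp only [hg] at hxy
        rw [smul_sub, eq_comm, neg_eq_iff_add_eq_zero]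
        have : x + t • v x - (y + t • v y) = 0 := sub_eq_zero.2 hxy
        rw [← this]; abel
      have h2 : ‖x - y‖ ≤ t * (L * ‖x - y‖) := by
        calc ‖x - y‖ = t * ‖v x - v y‖ := by
              conv_lhs => rw [h1]
              rw [norm_neg, norm_smul, Real.norm_eq_abs, abs_of_pos ht]
          _ ≤ _ := by gcongr; exact hLip x (hUB hx) y (hUB hy)
      have h3 : ‖x - y‖ = 0 := by nlinarith [norm_nonneg (x - y)]
      exact sub_eq_zero.1 (norm_eq_zero.1 h3)
    have himg : g '' U = U := by
      apply Subset.antisymm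
      · rintro _ ⟨x, hx, rfl⟩
        have hx' : ‖x‖ < 1 := by simpa [hU] using hx
        rw [hU, mem_ball_zero_iff]
        have : g x = (1 - t) • x + t • r x := by
          simp only [hg, hv]; module
        rw [this]
        refine (norm_add_le _ _).trans_lt ?_
        rw [norm_smul, norm_smul, hr1 x (hUB hx), Real.norm_eq_abs, Real.norm_eq_abs,
          abs_of_pos ht, abs_of_pos (by linarith : 0 < 1 - t)]
        nlinarith
      · intro y hy
        have hy' : ‖y‖ < 1 := by simpa [hU] using hy
        have hc : ContractingWith (Real.toNNReal (t * L)) (fun x => y - t • v (P x)) := by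
          refine ⟨by rwa [Real.toNNReal_lt_one], LipschitzWith.of_dist_le_mul fun a b => ?_⟩
          rw [dist_eq_norm, dist_eq_norm]
          have : y - t • v (P a) - (y - t • v (P b)) = t • (v (P b) - v (P a)) := by module
          rw [this, norm_smul, Real.norm_eq_abs, abs_of_pos ht]
          have h1 := hLip _ (hPB b) _ (hPB a)
          have h2 := hP1.dist_le_mul b a
          rw [NNReal.coe_one, one_mul, dist_eq_norm, dist_eq_norm] at h2
          calc t * ‖v (P b) - v (P a)‖ ≤ t * (L * ‖b - a‖) := by gcongr; exact h1.trans (by gcongr)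
            _ = _ := by rw [norm_sub_rev b a, Real.coe_toNNReal _ (by positivity)]; ring
        set x := hc.fixedPoint with hx
        have hfix : y - t • v (P x) = x := hc.fixedPoint_isFixedPt
        have hx1 : ‖x‖ < 1 := by
          by_contra hge
          push Not at hge
          rw [hvs _ (hPs x hge), smul_zero, sub_zero] at hfix
          rw [hfix] at hy'
          linarith
        have hxU : x ∈ U := by simpa [hU] using hx1
        refine ⟨x, hxU, ?_⟩
        rw [hPid x (hUB hxU)] at hfix
        exact (sub_eq_iff_eq_add.1 hfix).symm
    have hder : ∀ x ∈ U, HasFDerivWithinAt g (1 + t • fderiv ℝ v x) U x := fun x hx =>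
      ((hasFDerivAt_id x).add ((hvd x (hUB hx)).hasFDerivAt.const_smul t)).hasFDerivWithinAt
    have hcv := integral_image_eq_integral_abs_det_fderiv_smul volume measurableSet_ball hder hinj
      (fun _ => (1:ℝ))
    rw [himg] at hcv
    rw [hcv]
    refine setIntegral_congr_fun measurableSet_ball fun x hx => ?_
    have : ‖t • fderiv ℝ v x‖ < 1 := by
      rw [norm_smul, Real.norm_eq_abs, abs_of_pos ht]
      have := hLb x (hUB hx)
      nlinarith
    simp only [smul_eq_mul, mul_one]
    rw [abs_of_pos (det_one_add_pos this)]
  obtain ⟨c, hc⟩ := exists_det_interpolation (E := E) (fun i : ℕ => 1 / ((i + 2) * L)) (by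
    intro i j hij
    simp only at hij
    rw [div_eq_div_iff (by positivity) (by positivity), one_mul, one_mul] at hij
    have := mul_right_cancel₀ hLpos.ne' hij
    have h' : (j:ℝ) = i := by linarith
    exact_mod_cast h'.symm)
  have hcsum : ∑ i ∈ Finset.range (Module.finrank ℝ E + 1), c i = 1 := by
    have hd1 : (1 : E →L[ℝ] E).det = 1 := LinearMap.det_id
    have := hc 0
    simp only [smul_zero, add_zero, hd1, mul_one] at this
    exact this.symm
  have hdc : ∀ t : ℝ, IntegrableOn (fun x => (1 + t • fderiv ℝ v x).det) U := by
    intro t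
    refine (ContinuousOn.integrableOn_compact hBc ?_).mono_set hUB
    exact ContinuousLinearMap.continuous_det.comp_continuousOn
      (continuousOn_const.add (hDc.const_smul t))
  have h1 : ∫ x in U, (1 + fderiv ℝ v x).det = ∫ x in U, (1:ℝ) := by
    rw [integral_congr_ae (Eventually.of_forall fun x => hc (fderiv ℝ v x))]
    rw [integral_finsetSum _ fun i _ => (hdc _).const_mul _]
    simp_rw [integral_const_mul]
    rw [Finset.sum_congr rfl (fun i _ => by
      rw [hvol (1 / ((i + 2) * L)) (by positivity) (by
        rw [div_mul_eq_mul_div, div_lt_one (by positivity)]; nlinarith)]), ← Finset.sum_mul,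
      hcsum, one_mul]
  have h0 : ∫ x in U, (1 + fderiv ℝ v x).det = 0 := by
    rw [setIntegral_congr_fun (g := fun _ => (0:ℝ)) measurableSet_ball]
    · simp
    intro x hx
    have hrd : HasFDerivAt r (1 + fderiv ℝ v x) x := by
      have h := (hasFDerivAt_id x).add (hvd x (hUB hx)).hasFDerivAt
      have e : r = id + v := by ext y; simp [hv]
      rw [e]; exact h
    by_contra hne
    have hn : HasFDerivAt (fun y => ‖r y‖ ^ 2) (2 • (innerSL ℝ (r x)).comp (1 + fderiv ℝ v x)) x :=
      hrd.norm_sq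
    have hconst : (fun y => ‖r y‖ ^ 2) =ᶠ[𝓝 x] fun _ => (1:ℝ) := by
      filter_upwards [Metric.isOpen_ball.mem_nhds hx] with y hy
      rw [hr1 y (hUB hy), one_pow]
    have hz := hn.unique ((hasFDerivAt_const (1:ℝ) x).congr_of_eventuallyEq hconst)
    have hsurj : Function.Surjective (1 + fderiv ℝ v x : E →L[ℝ] E) := by
      have hu : IsUnit (LinearMap.det ((1 + fderiv ℝ v x : E →L[ℝ] E) : E →ₗ[ℝ] E)) :=
        isUnit_iff_ne_zero.2 hne
      have h2 := (LinearMap.isUnit_iff_isUnit_det _).2 hu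
      exact ((Module.End.isUnit_iff _).1 h2).2
    obtain ⟨y, hy⟩ := hsurj (r x)
    have := congrArg (fun T : E →L[ℝ] ℝ => T y) hz
    simp only [_root_.smul_apply, ContinuousLinearMap.comp_apply, hy,
      innerSL_apply_apply, real_inner_self_eq_norm_sq, hr1 x (hUB hx),
      _root_.zero_apply] at this
    norm_num at this
  rw [h0] at h1
  simp only [integral_const, smul_eq_mul, mul_one, measureReal_restrict_apply_univ] at h1
  have : 0 < volume.real U := by
    rw [measureReal_def]
    exact ENNReal.toReal_pos (Metric.measure_ball_pos volume 0 one_pos).ne' measure_ball_lt_top.ne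
  linarith

end Brouwer

section Fixed
variable {E : Type*} [NormedAddCommGroup E] [InnerProductSpace ℝ E] [FiniteDimensional ℝ E]

/-- Brouwer's theorem for smooth self-maps of the unit ball. -/
theorem exists_fixedPoint_of_contDiff {p : E → E} (hp : ContDiff ℝ 1 p)
    (hp1 : ∀ x, ‖p x‖ ≤ 1) : ∃ x, ‖x‖ ≤ 1 ∧ p x = x := by
  borelize E
  rcases subsingleton_or_nontrivial E with hE | hE
  · exact ⟨0, by simp, Subsingleton.elim _ _⟩
  by_contra hno
  push Not at hno
  let u : E → E := fun x => x - p x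
  let a : E → ℝ := fun x => inner ℝ x (u x)
  let D : E → ℝ := fun x => a x ^ 2 + ‖u x‖ ^ 2 * (1 - ‖x‖ ^ 2)
  let l : E → ℝ := fun x => (√(D x) - a x) / ‖u x‖ ^ 2
  let r : E → E := fun x => x + l x • u x
  have hu0 : ∀ x, ‖x‖ ≤ 1 → 0 < ‖u x‖ ^ 2 := fun x hx => by
    have : u x ≠ 0 := fun h => hno x hx (sub_eq_zero.1 h).symm
    positivity
  have ha : ∀ x, ‖x‖ = 1 → 0 < a x := by
    intro x hx
    have h1 : a x = 1 - inner ℝ x (p x) := by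
      simp only [a, u, inner_sub_right, real_inner_self_eq_norm_sq, hx]; norm_num
    have h2 := hu0 x hx.le
    have h3 : ‖u x‖ ^ 2 = 1 - 2 * inner ℝ x (p x) + ‖p x‖ ^ 2 := by
      simp only [u, norm_sub_sq_real, hx]; norm_num
    have h4 := hp1 x
    have h5 := norm_nonneg (p x)
    nlinarith
  have hD : ∀ x, ‖x‖ ≤ 1 → 0 < D x := by
    intro x hx
    rcases hx.lt_or_eq with h | h
    · have h1 := hu0 x hx
      have h2 : 0 < 1 - ‖x‖ ^ 2 := by nlinarith [norm_nonneg x]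
      have := mul_pos h1 h2
      simp only [D]; positivity
    · have := ha x h
      simp only [D, h]; norm_num; positivity
  have huC : ContDiff ℝ 1 u := contDiff_id.sub hp
  have haC : ContDiff ℝ 1 a := contDiff_id.inner ℝ huC
  have hDC : ContDiff ℝ 1 D :=
    (haC.pow 2).add ((huC.norm_sq ℝ).mul (contDiff_const.sub (contDiff_id.norm_sq ℝ)))
  refine not_exists_smooth_retraction (r := r) ?_ ?_ ?_
  · intro x hx
    rw [mem_closedBall_zero_iff] at hx
    exact contDiffAt_id.add ((((hDC.contDiffAt.sqrt (hD x hx).ne').sub haC.contDiffAt).div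
      (huC.norm_sq ℝ).contDiffAt (hu0 x hx).ne').smul huC.contDiffAt)
  · intro x hx
    rw [mem_closedBall_zero_iff] at hx
    have h1 := hu0 x hx
    have h2 : l x * ‖u x‖ ^ 2 = √(D x) - a x := div_mul_cancel₀ _ h1.ne'
    have h3 : √(D x) ^ 2 = D x := Real.sq_sqrt (hD x hx).le
    have h4 : ‖r x‖ ^ 2 = ‖x‖ ^ 2 + 2 * (l x * a x) + l x ^ 2 * ‖u x‖ ^ 2 := by
      simp only [r, norm_add_sq_real, inner_smul_right, norm_smul, mul_pow, a, Real.norm_eq_abs,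
        sq_abs]
    have h5 : ‖u x‖ ^ 2 * (‖r x‖ ^ 2 - 1) = 0 := by
      have h6 : D x = a x ^ 2 + ‖u x‖ ^ 2 * (1 - ‖x‖ ^ 2) := rfl
      rw [h4]
      linear_combination (2 * a x + l x * ‖u x‖ ^ 2 + (√(D x) - a x)) * h2 + h3 + h6
    have h7 : ‖r x‖ ^ 2 - 1 = 0 := (mul_eq_zero.1 h5).resolve_left h1.ne'
    nlinarith [norm_nonneg (r x)]
  · intro x hx
    have h1 : D x = a x ^ 2 := by simp [D, hx]
    have : l x = 0 := by
      simp only [l, h1, Real.sqrt_sq (ha x hx).le, sub_self, zero_div]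
    simp [r, this]

/-- Brouwer's theorem for the unit ball. -/
theorem exists_fixedPoint_of_norm_le_one {f : E → E} (hf : Continuous f)
    (hf1 : ∀ x, ‖f x‖ ≤ 1) : ∃ x, ‖x‖ ≤ 1 ∧ f x = x := by
  by_contra hno
  push Not at hno
  obtain ⟨x₀, hx₀, hmin⟩ := (isCompact_closedBall (0:E) 1).exists_isMinOn ⟨0, by simp⟩
    (f := fun x => ‖f x - x‖) (by fun_prop)
  rw [mem_closedBall_zero_iff] at hx₀
  set δ := ‖f x₀ - x₀‖ with hδ
  have hδpos : 0 < δ := norm_pos_iff.2 (sub_ne_zero.2 (hno x₀ hx₀))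
  set ε := δ / 4 with hε
  have hεpos : 0 < ε := by positivity
  obtain ⟨g, hgC, hg, -⟩ := hf.exists_contDiff_approx 1 (ε := fun _ => ε) continuous_const
    (fun _ => hεpos)
  have hgn : ∀ x, ‖g x‖ ≤ 1 + ε := fun x => by
    have h1 := hg x
    rw [dist_eq_norm] at h1
    calc ‖g x‖ = ‖f x + (g x - f x)‖ := by congr 1; abel
      _ ≤ ‖f x‖ + ‖g x - f x‖ := norm_add_le _ _
      _ ≤ 1 + ε := add_le_add (hf1 x) h1.le
  obtain ⟨x, hx1, hx⟩ := exists_fixedPoint_of_contDiff (p := fun x => (1 + ε)⁻¹ • g x)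
    (contDiff_const.smul hgC) (fun x => by
      rw [norm_smul, Real.norm_eq_abs, abs_of_pos (by positivity), inv_mul_le_iff₀ (by positivity),
        mul_one]
      exact hgn x)
  have hgx : g x = (1 + ε) • x := by
    rw [← hx, smul_smul, mul_inv_cancel₀ (by positivity), one_smul]
    simp only [hx]
  have h1 : δ ≤ ‖f x - x‖ := hmin (by simpa using hx1)
  have h2 : f x - x = -(g x - f x) + ε • x := by rw [hgx]; module
  have h3 := hg x
  rw [dist_eq_norm] at h3
  have h4 : ‖f x - x‖ ≤ ε + ε * 1 := by
    rw [h2]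
    refine (norm_add_le _ _).trans ?_
    rw [norm_neg, norm_smul, Real.norm_eq_abs, abs_of_pos hεpos]
    gcongr
  linarith

/-- Brouwer's theorem for compact convex sets. -/
theorem exists_fixedPoint_of_isCompact_convex {S : Set E} (hne : S.Nonempty) (hS : IsCompact S)
    (hconv : Convex ℝ S) {f : E → E} (hf : ContinuousOn f S) (hfS : MapsTo f S S) :
    ∃ x ∈ S, f x = x := by
  obtain ⟨P, hP1, hPS, hPid, -⟩ := exists_metric_projection hne hS.isClosed hconv
  obtain ⟨R, hR0, hR⟩ := hS.isBounded.exists_pos_norm_le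
  have hc : Continuous fun x => R⁻¹ • f (P (R • x)) :=
    (hf.comp_continuous (hP1.continuous.comp (continuous_const_smul R))
      (fun x => hPS _)).const_smul _
  obtain ⟨x, -, hx⟩ := exists_fixedPoint_of_norm_le_one hc (fun x => by
    rw [norm_smul, Real.norm_eq_abs, abs_of_pos (by positivity), inv_mul_le_iff₀ hR0, mul_one]
    exact hR _ (hfS (hPS _)))
  have h1 : f (P (R • x)) = R • x := by
    conv_rhs => rw [← hx]
    rw [smul_smul, mul_inv_cancel₀ hR0.ne', one_smul]
  have h2 : R • x ∈ S := h1 ▸ hfS (hPS _)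
  rw [hPid _ h2] at h1
  exact ⟨_, h2, h1⟩

end Fixed

/-- Brouwer's theorem for the standard simplex. -/
theorem exists_fixedPoint_stdSimplex {ι : Type*} [Fintype ι] [Nonempty ι]
    {f : (ι → ℝ) → (ι → ℝ)} (hf : ContinuousOn f (stdSimplex ℝ ι))
    (hfS : MapsTo f (stdSimplex ℝ ι) (stdSimplex ℝ ι)) : ∃ x ∈ stdSimplex ℝ ι, f x = x := by
  classical
  let e := EuclideanSpace.equiv ι ℝ
  let S : Set (EuclideanSpace ℝ ι) := e ⁻¹' stdSimplex ℝ ι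
  have hne : S.Nonempty := by
    obtain ⟨i⟩ := ‹Nonempty ι›
    exact ⟨e.symm (Pi.single i 1), by simpa [S] using single_mem_stdSimplex ℝ i⟩
  have hSc : IsCompact S := e.toHomeomorph.isCompact_preimage.2 (isCompact_stdSimplex ℝ ι)
  have hSconv : Convex ℝ S := (convex_stdSimplex ℝ ι).linear_preimage e.toLinearMap
  obtain ⟨x, hxS, hx⟩ := exists_fixedPoint_of_isCompact_convex hne hSc hSconv
    (f := fun x => e.symm (f (e x)))
    (e.symm.continuous.comp_continuousOn (hf.comp e.continuous.continuousOn fun x hx => hx))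
    (fun x hx => by simpa [S] using hfS hx)
  exact ⟨e x, hxS, by simpa using congrArg e hx⟩

/-- Schauder's fixed point theorem. -/
theorem exists_fixedPoint_of_mapsTo_compact {E : Type*} [NormedAddCommGroup E] [NormedSpace ℝ E]
    {Y C : Set E} (hne : Y.Nonempty) (hY : Convex ℝ Y) (hC : IsCompact C) (hCY : C ⊆ Y)
    {f : E → E} (hf : ContinuousOn f Y) (hfC : MapsTo f Y C) : ∃ x ∈ Y, f x = x := by
  have happ : ∀ ε > 0, ∃ x ∈ Y, dist x (f x) ≤ ε := by
    intro ε hε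
    obtain ⟨t, htC, hcov⟩ := hC.elim_finite_subcover_image (b := C) (c := fun y => Metric.ball y ε)
      (fun _ _ => Metric.isOpen_ball)
      (fun x hx => mem_iUnion₂.2 ⟨x, hx, Metric.mem_ball_self hε⟩)
    obtain ⟨htfin, hcov⟩ := hcov
    have : Fintype t := htfin.fintype
    obtain ⟨y₀, hy₀⟩ := hne
    have : Nonempty t := by
      obtain ⟨i, hi, -⟩ := mem_iUnion₂.1 (hcov (hfC hy₀))
      exact ⟨⟨i, hi⟩⟩
    let φ : t → E → ℝ := fun i x => max 0 (ε - dist x i)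
    have hφ0 : ∀ i x, 0 ≤ φ i x := fun i x => le_max_left _ _
    have hφc : ∀ i, Continuous (φ i) := fun i => by fun_prop
    let s : E → ℝ := fun x => ∑ i, φ i x
    have hs : ∀ x ∈ C, 0 < s x := by
      intro x hx
      obtain ⟨i, hi, hxi⟩ := mem_iUnion₂.1 (hcov hx)
      refine Finset.sum_pos' (fun i _ => hφ0 i x) ⟨⟨i, hi⟩, Finset.mem_univ _, ?_⟩
      exact lt_max_of_lt_right (by simpa [sub_pos] using hxi)
    let q : (t → ℝ) → E := fun a => ∑ i, a i • (i : E)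
    have hqc : Continuous q := by fun_prop
    have hqY : ∀ a ∈ stdSimplex ℝ t, q a ∈ Y := fun a ha =>
      hY.sum_mem (fun i _ => ha.1 i) ha.2 (fun i _ => hCY (htC i.2))
    obtain ⟨a, ha, hfix⟩ := exists_fixedPoint_stdSimplex
      (f := fun a : t → ℝ => fun i => φ i (f (q a)) / s (f (q a))) (by
        have h1 : ContinuousOn (fun a => f (q a)) (stdSimplex ℝ t) :=
          hf.comp hqc.continuousOn hqY
        refine continuousOn_pi.2 fun i => ContinuousOn.div ((hφc i).comp_continuousOn h1)
          ((continuous_finsetSum _ fun i _ => hφc i).comp_continuousOn h1) ?_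
        exact fun a ha => (hs _ (hfC (hqY a ha))).ne') (by
        intro a ha
        have := hs _ (hfC (hqY a ha))
        refine ⟨fun i => div_nonneg (hφ0 _ _) this.le, ?_⟩
        rw [← Finset.sum_div]
        exact div_self this.ne')
    refine ⟨q a, hqY a ha, ?_⟩
    set z := f (q a) with hz
    have hball : q a ∈ Metric.closedBall z ε := by
      have : q a = ∑ i ∈ Finset.univ.filter (fun i => a i ≠ 0), a i • (i : E) := by
        rw [Finset.sum_filter_of_ne]
        intro i _ hi h0
        exact hi (by rw [h0, zero_smul])
      rw [this]
      refine (convex_closedBall z ε).sum_mem (fun i _ => ha.1 i) ?_ ?_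
      · rw [Finset.sum_filter_ne_zero]; exact ha.2
      · intro i hi
        have hai : a i ≠ 0 := (Finset.mem_filter.1 hi).2
        have h1 : φ i z / s z = a i := congrFun hfix i
        have h2 : φ i z ≠ 0 := fun h => hai (by rw [← h1, h, zero_div])
        rw [Metric.mem_closedBall]
        by_contra hgt
        push Not at hgt
        exact h2 (max_eq_left (by rw [dist_comm]; linarith))
    exact hball
  choose x hxY hx using fun n : ℕ => happ (1 / ((n:ℝ) + 1)) (by positivity)
  obtain ⟨z, hzC, φ, hφ, hlim⟩ := hC.tendsto_subseq fun n => hfC (hxY n)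
  have hd : Tendsto (fun n => dist (x (φ n)) (f (x (φ n)))) atTop (𝓝 0) :=
    squeeze_zero (fun _ => dist_nonneg) (fun n => hx _)
      (tendsto_one_div_add_atTop_nhds_zero_nat.comp hφ.tendsto_atTop)
  have hxz : Tendsto (fun n => x (φ n)) atTop (𝓝 z) :=
    hlim.congr_dist (by simpa [dist_comm] using hd)
  have h1 : Tendsto (fun n => f (x (φ n))) atTop (𝓝 (f z)) :=
    (hf z (hCY hzC)).tendsto.comp (tendsto_nhdsWithin_iff.2
      ⟨hxz, Eventually.of_forall fun n => hxY _⟩)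
  exact ⟨z, hCY hzC, tendsto_nhds_unique h1 hlim⟩

section Coagulation
variable {γ C ρ β κ M : ℝ} {K : ℝ → ℝ → ℝ} {g : ℝ → ℝ} {u : ℕ → ℝ → ℝ}

/-- The part of the assumptions on the kernel and the exponents used in the fixed point argument;
the kernel is assumed to be measurable and nonnegative everywhere. -/
structure Setting (K : ℝ → ℝ → ℝ) (γ C ρ β κ : ℝ) : Prop where
  gamma_nonneg : 0 ≤ γ
  gamma_lt : γ < ρ
  rho_lt : ρ < 1
  beta_pos : 0 < β
  C_pos : 0 < C
  rho_le : ρ ≤ κ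
  measurable : Measurable fun p : ℝ × ℝ => K p.1 p.2
  nonneg : ∀ x y, 0 ≤ K x y
  growth : ∀ x y : ℝ, 0 < x → 0 < y → K x y ≤ C * (x ^ γ + y ^ γ)

/-- The pointwise weight `x^{-ρ} + x^{-κ}`. -/
def wt (ρ κ x : ℝ) : ℝ := x ^ (-ρ) + x ^ (-κ)

/-- Densities dominated by `M (x^{-ρ} + x^{-κ})` with the mass bound `∫_0^R g ≤ R^{1-ρ}`. -/
structure Adm (ρ κ M : ℝ) (g : ℝ → ℝ) : Prop where
  meas : Measurable g
  nonneg : ∀ x, 0 ≤ g x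
  le : ∀ x, 0 < x → g x ≤ M * wt ρ κ x
  int : ∀ R, 0 < R → IntegrableOn g (Ioc 0 R)
  mass : ∀ R, 0 < R → ∫ x in Ioc 0 R, g x ≤ R ^ (1 - ρ)

lemma wt_pos {x : ℝ} (hx : 0 < x) : 0 < wt ρ κ x :=
  add_pos (rpow_pos_of_pos hx _) (rpow_pos_of_pos hx _)

lemma measurable_wt : Measurable (wt ρ κ) := by unfold wt; fun_prop

lemma continuousOn_wt : ContinuousOn (wt ρ κ) (Ioi 0) := by
  refine ContinuousOn.add ?_ ?_ <;>
  exact fun x hx => (continuousAt_rpow_const _ _ (Or.inl (ne_of_gt hx))).continuousWithinAt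

lemma wt_anti (hρ : 0 ≤ ρ) (hκ : 0 ≤ κ) {x y : ℝ} (hx : 0 < x) (hxy : x ≤ y) :
    wt ρ κ y ≤ wt ρ κ x :=
  add_le_add (rpow_le_rpow_of_nonpos hx hxy (by linarith))
    (rpow_le_rpow_of_nonpos hx hxy (by linarith))

lemma wt_half_le (hκ : ρ ≤ κ) {x : ℝ} (hx : 0 < x) :
    wt ρ κ (x / 2) ≤ 2 ^ κ * wt ρ κ x := by
  have h : ∀ p : ℝ, (x / 2) ^ (-p) = 2 ^ p * x ^ (-p) := fun p => by
    rw [div_rpow hx.le (by norm_num), rpow_neg (by norm_num : (0:ℝ) ≤ 2), div_inv_eq_mul, mul_comm]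
  unfold wt
  rw [h, h, mul_add]
  gcongr
  norm_num

lemma Adm.lintegral_mass (hg : Adm ρ κ M g) {R : ℝ} (hR : 0 < R) :
    ∫⁻ x in Ioc 0 R, ENNReal.ofReal (g x) ≤ ENNReal.ofReal (R ^ (1 - ρ)) := by
  rw [← ofReal_integral_eq_lintegral_ofReal (hg.int R hR) (Eventually.of_forall hg.nonneg)]
  exact ENNReal.ofReal_le_ofReal (hg.mass R hR)

lemma integral_Ioi_rpow_mul {a r : ℝ} (ha : a < 0) (hr : 0 < r) :
    ∫⁻ s in Ioi r, ENNReal.ofReal (s ^ (a - 1)) = ENNReal.ofReal (r ^ a / (-a)) := by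
  rw [← ofReal_integral_eq_lintegral_ofReal (integrableOn_Ioi_rpow_of_lt (by linarith) hr),
    integral_Ioi_rpow_of_lt (by linarith) hr]
  · congr 1
    rw [sub_add_cancel, div_neg, neg_div]
  · filter_upwards [ae_restrict_mem measurableSet_Ioi] with s hs
    exact rpow_nonneg (hr.trans hs).le _

lemma Adm.lintegral_tail (hg : Adm ρ κ M g) {a r : ℝ} (ha : a < 0) (haρ : a < ρ - 1)
    (hr : 0 < r) :
    ∫⁻ z in Ioi r, ENNReal.ofReal (z ^ a * g z)
      ≤ ENNReal.ofReal (-a / (ρ - 1 - a) * r ^ (a + 1 - ρ)) := by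
  have hgm := hg.meas
  have e1 : ∀ z ∈ Ioi r, ENNReal.ofReal (z ^ a * g z) = ∫⁻ s in Ioi r,
      (Ioi z).indicator (fun s => ENNReal.ofReal (-a * s ^ (a - 1)) * ENNReal.ofReal (g z)) s := by
    intro z hz
    have hz0 : 0 < z := hr.trans hz
    rw [lintegral_indicator measurableSet_Ioi, Measure.restrict_restrict measurableSet_Ioi,
      inter_eq_left.2 (Ioi_subset_Ioi (le_of_lt hz)), lintegral_mul_const _ (by fun_prop)]
    simp_rw [ENNReal.ofReal_mul (show 0 ≤ -a by linarith)]
    rw [lintegral_const_mul _ (by fun_prop), integral_Ioi_rpow_mul ha hz0,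
      ← ENNReal.ofReal_mul (by linarith), ← ENNReal.ofReal_mul (by
        have := rpow_pos_of_pos hz0 a
        have : 0 < -a := by linarith
        positivity)]
    congr 1
    have := ha.ne
    field_simp
  rw [setLIntegral_congr_fun measurableSet_Ioi e1, lintegral_lintegral_swap]
  · have e2 : ∀ s ∈ Ioi r, ∫⁻ z in Ioi r, (Ioi z).indicator
        (fun s => ENNReal.ofReal (-a * s ^ (a - 1)) * ENNReal.ofReal (g z)) s
        ≤ ENNReal.ofReal (-a) * ENNReal.ofReal (s ^ (a + 1 - ρ - 1)) := by
      intro s hs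
      have hs0 : 0 < s := hr.trans hs
      calc _ ≤ ∫⁻ z in Ioi r, (Ioc 0 s).indicator
            (fun z => ENNReal.ofReal (-a * s ^ (a - 1)) * ENNReal.ofReal (g z)) z := by
            refine setLIntegral_mono (by fun_prop (disch := measurability)) fun z hz => ?_
            by_cases h : z < s
            · rw [indicator_of_mem (show s ∈ Ioi z from h),
                indicator_of_mem (show z ∈ Ioc 0 s from ⟨hr.trans hz, h.le⟩)]
            · rw [indicator_of_notMem (show s ∉ Ioi z from h)]
              exact zero_le
        _ ≤ ∫⁻ z, (Ioc 0 s).indicator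
            (fun z => ENNReal.ofReal (-a * s ^ (a - 1)) * ENNReal.ofReal (g z)) z :=
            setLIntegral_le_lintegral _ _
        _ = ENNReal.ofReal (-a * s ^ (a - 1)) * ∫⁻ z in Ioc 0 s, ENNReal.ofReal (g z) := by
            rw [lintegral_indicator measurableSet_Ioc, lintegral_const_mul _ (by fun_prop)]
        _ ≤ ENNReal.ofReal (-a * s ^ (a - 1)) * ENNReal.ofReal (s ^ (1 - ρ)) := by
            gcongr; exact hg.lintegral_mass hs0
        _ = _ := by
            rw [ENNReal.ofReal_mul (by linarith), mul_assoc,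
              ← ENNReal.ofReal_mul (rpow_nonneg hs0.le _), ← rpow_add hs0]
            congr 3; ring
    refine (setLIntegral_mono (by fun_prop) e2).trans ?_
    rw [lintegral_const_mul _ (by fun_prop), integral_Ioi_rpow_mul (by linarith) hr,
      ← ENNReal.ofReal_mul (by linarith)]
    refine ENNReal.ofReal_le_ofReal (le_of_eq ?_)
    rw [show -(a + 1 - ρ) = ρ - 1 - a by ring]
    ring
  · refine Measurable.aemeasurable ?_
    have : (Function.uncurry fun z s => (Ioi z).indicator
        (fun s => ENNReal.ofReal (-a * s ^ (a - 1)) * ENNReal.ofReal (g z)) s)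
        = {p : ℝ × ℝ | p.1 < p.2}.indicator
          (fun p => ENNReal.ofReal (-a * p.2 ^ (a - 1)) * ENNReal.ofReal (g p.1)) := by
      ext ⟨z, s⟩
      simp [Function.uncurry, indicator]
    rw [this]
    exact Measurable.indicator (by fun_prop) (measurableSet_lt measurable_fst measurable_snd)

lemma Adm.integrableOn_tail (hg : Adm ρ κ M g) {a r : ℝ} (ha : a < 0) (haρ : a < ρ - 1)
    (hr : 0 < r) : IntegrableOn (fun z => z ^ a * g z) (Ioi r) := by
  have hgm := hg.meas
  refine ⟨(by fun_prop : Measurable fun z => z ^ a * g z).aestronglyMeasurable, ?_⟩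
  rw [hasFiniteIntegral_iff_ofReal]
  · exact (hg.lintegral_tail ha haρ hr).trans_lt ENNReal.ofReal_lt_top
  · filter_upwards [ae_restrict_mem measurableSet_Ioi] with z hz
    exact mul_nonneg (rpow_nonneg (hr.trans hz).le _) (hg.nonneg z)

lemma Adm.integral_tail_le (hg : Adm ρ κ M g) {a r : ℝ} (ha : a < 0) (haρ : a < ρ - 1)
    (hr : 0 < r) :
    ∫ z in Ioi r, z ^ a * g z ≤ -a / (ρ - 1 - a) * r ^ (a + 1 - ρ) := by
  have h0 : 0 ≤ᵐ[volume.restrict (Ioi r)] fun z => z ^ a * g z := by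
    filter_upwards [ae_restrict_mem measurableSet_Ioi] with z hz
    exact mul_nonneg (rpow_nonneg (hr.trans hz).le _) (hg.nonneg z)
  have h := hg.lintegral_tail ha haρ hr
  rw [← ofReal_integral_eq_lintegral_ofReal (hg.integrableOn_tail ha haρ hr) h0] at h
  refine (ENNReal.ofReal_le_ofReal_iff ?_).1 h
  have : 0 < -a := by linarith
  have : 0 < ρ - 1 - a := by linarith
  have := rpow_pos_of_pos hr (a + 1 - ρ)
  positivity

/-- The inner integral in `Ifun`. -/
def innerInt (K : ℝ → ℝ → ℝ) (g : ℝ → ℝ) (x y : ℝ) : ℝ := ∫ z in Ioi (x - y), K y z / z * g z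

lemma Ifun_eq (x : ℝ) : Ifun K g x = ∫ y in Ioc 0 x, innerInt K g x y * g y := rfl

/-- The constant in the bound for the inner integral. -/
def cInner (γ C ρ : ℝ) : ℝ := C * (1 / ρ + (1 - γ) / (ρ - γ))

namespace Setting
variable (S : Setting K γ C ρ β κ)
include S

lemma rho_pos : 0 < ρ := S.gamma_nonneg.trans_lt S.gamma_lt

lemma cInner_pos : 0 < cInner γ C ρ := by
  have h1 := S.gamma_lt; have h2 := S.rho_lt; have h3 := S.rho_pos
  have h4 : 0 < ρ - γ := by linarith
  have h5 : 0 < 1 - γ := by linarith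
  have := S.C_pos
  unfold cInner; positivity

lemma kernel_div_le {y z : ℝ} (hy : 0 < y) (hz : 0 < z) :
    K y z / z ≤ C * (y ^ γ * z ^ (-1 : ℝ) + z ^ (γ - 1)) := by
  rw [rpow_neg_one, rpow_sub_one hz.ne', ← div_eq_mul_inv, ← add_div, ← mul_div_assoc]
  gcongr
  exact S.growth y z hy hz

lemma measurable_kernel (y : ℝ) : Measurable (K y) :=
  S.measurable.comp (measurable_const.prodMk measurable_id)

lemma innerInt_integrableOn (hg : Adm ρ κ M g) {r y : ℝ} (hy : 0 < y) (hr : 0 < r) :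
    IntegrableOn (fun z => K y z / z * g z) (Ioi r) := by
  have h1 := S.gamma_lt; have h2 := S.rho_lt; have h3 := S.rho_pos
  have i1 := hg.integrableOn_tail (a := -1) (by norm_num) (by linarith) hr
  have i2 := hg.integrableOn_tail (a := γ - 1) (by linarith) (by linarith) hr
  have hgm := hg.meas
  have hKm := S.measurable_kernel y
  refine (((i1.const_mul (y ^ γ)).add i2).const_mul C).mono' (by fun_prop) ?_
  filter_upwards [ae_restrict_mem measurableSet_Ioi] with z hz
  have hz0 : 0 < z := hr.trans hz
  have hk := S.nonneg y z
  have hg0 := hg.nonneg z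
  rw [Real.norm_eq_abs, abs_of_nonneg (by positivity)]
  calc _ ≤ C * (y ^ γ * z ^ (-1 : ℝ) + z ^ (γ - 1)) * g z := by
        gcongr; exact S.kernel_div_le hy hz0
    _ = _ := by simp only [Pi.add_apply]; ring

lemma innerInt_nonneg (hg : ∀ z, 0 ≤ g z) {x y : ℝ} (hyx : y ≤ x) : 0 ≤ innerInt K g x y := by
  refine setIntegral_nonneg measurableSet_Ioi fun z hz => ?_
  have : 0 < z := (sub_nonneg.2 hyx).trans_lt hz
  have := S.nonneg y z
  have := hg z
  positivity

lemma innerInt_le (hg : Adm ρ κ M g) {x y : ℝ} (hy : 0 < y) (hyx : y < x) :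
    innerInt K g x y ≤ cInner γ C ρ * x ^ γ * (x - y) ^ (-ρ) := by
  have h0 := S.gamma_nonneg
  have h1 := S.gamma_lt; have h2 := S.rho_lt; have h3 := S.rho_pos
  have hC := S.C_pos
  have hr : 0 < x - y := sub_pos.2 hyx
  have i1 := hg.integrableOn_tail (a := -1) (by norm_num) (by linarith) hr
  have i2 := hg.integrableOn_tail (a := γ - 1) (by linarith) (by linarith) hr
  have b1 := hg.integral_tail_le (a := -1) (by norm_num) (by linarith) hr
  have b2 := hg.integral_tail_le (a := γ - 1) (by linarith) (by linarith) hr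
  have hmono : innerInt K g x y ≤
      ∫ z in Ioi (x - y), C * (y ^ γ * (z ^ (-1 : ℝ) * g z) + z ^ (γ - 1) * g z) := by
    refine setIntegral_mono_on (S.innerInt_integrableOn hg hy hr)
      (((i1.const_mul (y ^ γ)).add i2).const_mul C) measurableSet_Ioi fun z hz => ?_
    have := S.kernel_div_le hy (hr.trans hz)
    have := mul_le_mul_of_nonneg_right this (hg.nonneg z)
    linarith
  rw [integral_const_mul, integral_add (i1.const_mul _) i2, integral_const_mul] at hmono
  refine hmono.trans ?_
  have hy' : y ^ γ ≤ x ^ γ := rpow_le_rpow hy.le hyx.le h0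
  have hxy' : (x - y) ^ γ ≤ x ^ γ := rpow_le_rpow hr.le (by linarith) h0
  have hxγ : 0 ≤ x ^ γ := rpow_nonneg (by linarith) _
  have e1 : -(-1 : ℝ) / (ρ - 1 - -1) * (x - y) ^ ((-1 : ℝ) + 1 - ρ) = 1 / ρ * (x - y) ^ (-ρ) := by
    congr 2 <;> ring
  have e2 : -(γ - 1) / (ρ - 1 - (γ - 1)) * (x - y) ^ (γ - 1 + 1 - ρ)
      = (1 - γ) / (ρ - γ) * ((x - y) ^ γ * (x - y) ^ (-ρ)) := by
    rw [← rpow_add hr]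
    congr 2 <;> ring
  rw [e1] at b1
  rw [e2] at b2
  have h4 : 0 < ρ - γ := by linarith
  have h5 : 0 < 1 - γ := by linarith
  have hp := rpow_pos_of_pos hr (-ρ)
  have hyγ := rpow_pos_of_pos hy γ
  calc _ ≤ C * (y ^ γ * (1 / ρ * (x - y) ^ (-ρ)) +
        (1 - γ) / (ρ - γ) * ((x - y) ^ γ * (x - y) ^ (-ρ))) := by gcongr
    _ ≤ C * (x ^ γ * (1 / ρ * (x - y) ^ (-ρ)) +
        (1 - γ) / (ρ - γ) * (x ^ γ * (x - y) ^ (-ρ))) := by gcongr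
    _ = _ := by unfold cInner; ring

end Setting
lemma Adm.M_nonneg (hg : Adm ρ κ M g) : 0 ≤ M := by
  have h := (hg.nonneg 1).trans (hg.le 1 one_pos)
  exact nonneg_of_mul_nonneg_left h (wt_pos one_pos)

lemma integrableOn_sub_rpow {x θ : ℝ} (hρ : ρ < 1) (hθ : 0 < θ) :
    IntegrableOn (fun y => (x - y) ^ (-ρ)) (Ioc (x - θ) x) := by
  have h := (intervalIntegral.intervalIntegrable_rpow' (a := 0) (b := θ) (r := -ρ)
    (by linarith)).comp_sub_left x
  rw [sub_zero] at h
  exact (intervalIntegrable_iff_integrableOn_Ioc_of_le (by linarith)).1 h.symm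

lemma integral_sub_rpow {x θ : ℝ} (hρ : ρ < 1) (hθ : 0 < θ) :
    ∫ y in Ioc (x - θ) x, (x - y) ^ (-ρ) = θ ^ (1 - ρ) / (1 - ρ) := by
  rw [← intervalIntegral.integral_of_le (by linarith),
    intervalIntegral.integral_comp_sub_left (fun y => y ^ (-ρ)), sub_self, sub_sub_cancel,
    integral_rpow (Or.inl (by linarith)), zero_rpow (by linarith), sub_zero,
    show -ρ + 1 = 1 - ρ by ring]

lemma ae_mem_Ioo (a b : ℝ) : ∀ᵐ y ∂volume.restrict (Ioc a b), y ∈ Ioo a b := by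
  rw [← Measure.restrict_congr_set Ioo_ae_eq_Ioc]
  exact ae_restrict_mem measurableSet_Ioo

namespace Setting
variable (S : Setting K γ C ρ β κ)
include S

lemma kappa_pos : 0 < κ := S.rho_pos.trans_le S.rho_le

lemma measurable_innerInt (hg : Measurable g) (x : ℝ) : Measurable (innerInt K g x) := by
  have h1 : Measurable (Function.uncurry fun y z : ℝ =>
      (Ioi (x - y)).indicator (fun z => K y z / z * g z) z) := by
    have : (Function.uncurry fun y z : ℝ =>
      (Ioi (x - y)).indicator (fun z => K y z / z * g z) z)
        = {p : ℝ × ℝ | x - p.1 < p.2}.indicator (fun p => K p.1 p.2 / p.2 * g p.2) := by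
      ext ⟨y, z⟩
      simp [Function.uncurry, indicator]
    rw [this]
    have := S.measurable
    exact Measurable.indicator (by fun_prop) (measurableSet_lt (by fun_prop) measurable_snd)
  have h2 := (h1.stronglyMeasurable.integral_prod_right (ν := volume)).measurable
  have h3 : innerInt K g x = fun y => ∫ z, (Ioi (x - y)).indicator (fun z => K y z / z * g z) z :=
    funext fun y => (integral_indicator measurableSet_Ioi).symm
  rw [h3]
  exact h2

lemma near_le (hg : Adm ρ κ M g) {x θ s : ℝ} (hθ : 0 < θ) (hθx : θ ≤ x)
    (hs : ∀ y ∈ Ioc (x - θ) x, g y ≤ s) :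
    IntegrableOn (fun y => innerInt K g x y * g y) (Ioc (x - θ) x) ∧
    ∫ y in Ioc (x - θ) x, innerInt K g x y * g y
      ≤ cInner γ C ρ * x ^ γ * (s * (θ ^ (1 - ρ) / (1 - ρ))) := by
  have hi : IntegrableOn (fun y => cInner γ C ρ * x ^ γ * (s * (x - y) ^ (-ρ)))
      (Ioc (x - θ) x) :=
    ((integrableOn_sub_rpow S.rho_lt hθ).const_mul s).const_mul (cInner γ C ρ * x ^ γ)
  have hb : ∀ᵐ y ∂volume.restrict (Ioc (x - θ) x), innerInt K g x y * g y
      ≤ cInner γ C ρ * x ^ γ * (s * (x - y) ^ (-ρ)) := by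
    filter_upwards [ae_mem_Ioo (x - θ) x] with y hy
    have h1 := S.innerInt_le hg (by linarith [hy.1]) hy.2
    have h2 := S.innerInt_nonneg hg.nonneg hy.2.le
    have h3 := hs y ⟨hy.1, hy.2.le⟩
    calc _ ≤ (cInner γ C ρ * x ^ γ * (x - y) ^ (-ρ)) * s :=
          mul_le_mul h1 h3 (hg.nonneg y) (h2.trans h1)
      _ = _ := by ring
  have hA : IntegrableOn (fun y => innerInt K g x y * g y) (Ioc (x - θ) x) := by
    refine Integrable.mono' hi
      ((S.measurable_innerInt hg.meas x).mul hg.meas).aestronglyMeasurable ?_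
    filter_upwards [hb, ae_mem_Ioo (x - θ) x] with y h1 hy
    rw [Real.norm_eq_abs, abs_of_nonneg]
    · exact h1
    · exact mul_nonneg (S.innerInt_nonneg hg.nonneg hy.2.le) (hg.nonneg y)
  refine ⟨hA, (integral_mono_ae hA hi hb).trans_eq ?_⟩
  rw [integral_const_mul, integral_const_mul, integral_sub_rpow S.rho_lt hθ]

lemma far_le (hg : Adm ρ κ M g) {x a : ℝ} (ha : 0 < a) (hax : a < x) :
    IntegrableOn (fun y => innerInt K g x y * g y) (Ioc 0 a) ∧
    ∫ y in Ioc 0 a, innerInt K g x y * g y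
      ≤ cInner γ C ρ * x ^ γ * ((x - a) ^ (-ρ) * ∫ y in Ioc 0 a, g y) := by
  have hi : IntegrableOn (fun y => cInner γ C ρ * x ^ γ * ((x - a) ^ (-ρ) * g y)) (Ioc 0 a) :=
    ((hg.int a ha).const_mul _).const_mul _
  have hb : ∀ y ∈ Ioc 0 a, innerInt K g x y * g y
      ≤ cInner γ C ρ * x ^ γ * ((x - a) ^ (-ρ) * g y) := by
    intro y hy
    have h1 := S.innerInt_le hg hy.1 (hy.2.trans_lt hax)
    have h2 : (x - y) ^ (-ρ) ≤ (x - a) ^ (-ρ) :=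
      rpow_le_rpow_of_nonpos (by linarith) (by linarith [hy.2]) (by linarith [S.rho_pos])
    have h3 := S.cInner_pos
    have h4 : 0 ≤ x ^ γ := rpow_nonneg (by linarith) _
    have h5 := hg.nonneg y
    calc _ ≤ (cInner γ C ρ * x ^ γ * (x - y) ^ (-ρ)) * g y := by gcongr
      _ ≤ (cInner γ C ρ * x ^ γ * (x - a) ^ (-ρ)) * g y := by gcongr
      _ = _ := by ring
  have hA : IntegrableOn (fun y => innerInt K g x y * g y) (Ioc 0 a) := by
    refine Integrable.mono' hi
      ((S.measurable_innerInt hg.meas x).mul hg.meas).aestronglyMeasurable ?_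
    filter_upwards [ae_restrict_mem measurableSet_Ioc] with y hy
    rw [Real.norm_eq_abs, abs_of_nonneg]
    · exact hb y hy
    · exact mul_nonneg (S.innerInt_nonneg hg.nonneg (by linarith [hy.2])) (hg.nonneg y)
  refine ⟨hA, (setIntegral_mono_on hA hi measurableSet_Ioc hb).trans_eq ?_⟩
  rw [integral_const_mul, integral_const_mul]

lemma near_bound (hg : Adm ρ κ M g) {x y : ℝ} (hx : 0 < x) (hy : x / 2 ≤ y) :
    g y ≤ 2 ^ κ * M * wt ρ κ x := by
  have h1 := hg.M_nonneg
  calc g y ≤ M * wt ρ κ y := hg.le y (by linarith)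
    _ ≤ M * wt ρ κ (x / 2) := by
        gcongr; exact wt_anti S.rho_pos.le S.kappa_pos.le (by linarith) hy
    _ ≤ M * (2 ^ κ * wt ρ κ x) := by gcongr; exact wt_half_le S.rho_le hx
    _ = _ := by ring

lemma integrableOn_Ifun (hg : Adm ρ κ M g) {x : ℝ} (hx : 0 < x) :
    IntegrableOn (fun y => innerInt K g x y * g y) (Ioc 0 x) := by
  rw [← Ioc_union_Ioc_eq_Ioc (by linarith : 0 ≤ x - x / 2) (by linarith)]
  exact (S.far_le hg (by linarith) (by linarith)).1.union (S.near_le hg (by linarith)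
    (by linarith) fun y hy => S.near_bound hg hx (by linarith [hy.1])).1

lemma Ifun_nonneg (hg : ∀ z, 0 ≤ g z) (x : ℝ) : 0 ≤ Ifun K g x :=
  setIntegral_nonneg measurableSet_Ioc fun y hy =>
    mul_nonneg (S.innerInt_nonneg hg hy.2) (hg y)

lemma Ifun_le_of_le (hg : Adm ρ κ M g) {x θ s : ℝ} (hθ : 0 < θ) (hθx : θ < x)
    (hs : ∀ y ∈ Ioc (x - θ) x, g y ≤ s) :
    Ifun K g x ≤ cInner γ C ρ * x ^ γ *
      (θ ^ (-ρ) * (∫ y in Ioc 0 (x - θ), g y) + s * (θ ^ (1 - ρ) / (1 - ρ))) := by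
  have h1 := S.far_le hg (sub_pos.2 hθx) (sub_lt_self x hθ)
  have h2 := S.near_le hg hθ hθx.le hs
  rw [Ifun_eq, ← Ioc_union_Ioc_eq_Ioc (by linarith : 0 ≤ x - θ) (by linarith),
    setIntegral_union (Ioc_disjoint_Ioc_of_le le_rfl) measurableSet_Ioc h1.1 h2.1, mul_add]
  rw [sub_sub_cancel] at h1
  exact add_le_add h1.2 h2.2

lemma Ifun_le (hg : Adm ρ κ M g) {x θ : ℝ} (hθ : 0 < θ) (hθx : θ ≤ x / 2) :
    Ifun K g x ≤ cInner γ C ρ * x ^ γ *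
      (θ ^ (-ρ) * x ^ (1 - ρ) + 2 ^ κ * M * wt ρ κ x * (θ ^ (1 - ρ) / (1 - ρ))) := by
  have hx : 0 < x := by linarith
  refine (S.Ifun_le_of_le hg hθ (by linarith) (s := 2 ^ κ * M * wt ρ κ x)
    fun y hy => S.near_bound hg hx (by linarith [hy.1])).trans ?_
  have h3 := S.cInner_pos
  have h4 : 0 ≤ x ^ γ := rpow_nonneg hx.le _
  have h5 : ∫ y in Ioc 0 (x - θ), g y ≤ x ^ (1 - ρ) :=
    (hg.mass _ (by linarith)).trans
      (rpow_le_rpow (by linarith) (by linarith) (by linarith [S.rho_lt]))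
  gcongr

/-- The constant in the growth bound for `Ifun`. -/
def _root_.Smol.cOuter (γ C ρ κ M : ℝ) : ℝ :=
  cInner γ C ρ * (2 ^ ρ + 2 ^ κ * M * (2 ^ (ρ - 1) / (1 - ρ)))

lemma Ifun_le_wt (hg : Adm ρ κ M g) {x : ℝ} (hx : 0 < x) :
    Ifun K g x ≤ cOuter γ C ρ κ M * (x ^ (1 + γ - ρ) * wt ρ κ x) := by
  refine (S.Ifun_le hg (half_pos hx) le_rfl).trans ?_
  have h3 := S.cInner_pos
  have h4 : 0 < x ^ γ := rpow_pos_of_pos hx _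
  have e1 : (x / 2) ^ (-ρ) = 2 ^ ρ * x ^ (-ρ) := by
    rw [div_rpow hx.le (by norm_num), rpow_neg (by norm_num : (0:ℝ) ≤ 2), div_inv_eq_mul, mul_comm]
  have e2 : (x / 2) ^ (1 - ρ) = 2 ^ (ρ - 1) * x ^ (1 - ρ) := by
    rw [div_rpow hx.le (by norm_num), show ρ - 1 = -(1 - ρ) by ring,
      rpow_neg (by norm_num : (0:ℝ) ≤ 2), div_eq_mul_inv, mul_comm]
  have e3 : x ^ (1 + γ - ρ) = x ^ γ * x ^ (1 - ρ) := by
    rw [← rpow_add hx]; congr 1; ring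
  have h6 : x ^ (-ρ) ≤ wt ρ κ x := le_add_of_nonneg_right (rpow_nonneg hx.le _)
  have h7 : 0 < x ^ (1 - ρ) := rpow_pos_of_pos hx _
  rw [e1, e2, e3]
  calc _ ≤ cInner γ C ρ * x ^ γ * (2 ^ ρ * wt ρ κ x * x ^ (1 - ρ)
        + 2 ^ κ * M * wt ρ κ x * (2 ^ (ρ - 1) * x ^ (1 - ρ) / (1 - ρ))) := by gcongr
    _ = _ := by unfold cOuter; ring

lemma abs_Ifun_sub_le (hg : Adm ρ κ M g) {x δ : ℝ} (hδ : 0 < δ) (hδx : δ ≤ x / 2) :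
    |Ifun K g x - ∫ y in Ioc δ (x - δ), innerInt K g x y * g y| ≤ cInner γ C ρ * x ^ γ *
      ((x / 2) ^ (-ρ) + 2 ^ κ * M * wt ρ κ x / (1 - ρ)) * δ ^ (1 - ρ) := by
  have hx : 0 < x := by linarith
  have h1 := S.far_le hg hδ (by linarith : δ < x)
  have h2 := S.near_le hg (x := x) hδ (by linarith) (s := 2 ^ κ * M * wt ρ κ x)
    fun y hy => S.near_bound hg hx (by linarith [hy.1])
  have h3 := S.integrableOn_Ifun hg hx
  have e1 : Ifun K g x = (∫ y in Ioc 0 δ, innerInt K g x y * g y) +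
      ((∫ y in Ioc δ (x - δ), innerInt K g x y * g y) +
        ∫ y in Ioc (x - δ) x, innerInt K g x y * g y) := by
    rw [Ifun_eq, ← Ioc_union_Ioc_eq_Ioc hδ.le (by linarith : δ ≤ x),
      setIntegral_union (Ioc_disjoint_Ioc_of_le le_rfl) measurableSet_Ioc h1.1
        (h3.mono_set (Ioc_subset_Ioc_left hδ.le)),
      ← Ioc_union_Ioc_eq_Ioc (by linarith : δ ≤ x - δ) (by linarith : x - δ ≤ x),
      setIntegral_union (Ioc_disjoint_Ioc_of_le le_rfl) measurableSet_Ioc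
        (h3.mono_set (Ioc_subset_Ioc hδ.le (by linarith))) h2.1]
  have n1 : 0 ≤ ∫ y in Ioc 0 δ, innerInt K g x y * g y :=
    setIntegral_nonneg measurableSet_Ioc fun y hy =>
      mul_nonneg (S.innerInt_nonneg hg.nonneg (by linarith [hy.2])) (hg.nonneg y)
  have n2 : 0 ≤ ∫ y in Ioc (x - δ) x, innerInt K g x y * g y :=
    setIntegral_nonneg measurableSet_Ioc fun y hy =>
      mul_nonneg (S.innerInt_nonneg hg.nonneg (by linarith [hy.2])) (hg.nonneg y)
  have h5 : (x - δ) ^ (-ρ) ≤ (x / 2) ^ (-ρ) :=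
    rpow_le_rpow_of_nonpos (by linarith) (by linarith) (by linarith [S.rho_pos])
  have h6 := hg.mass δ hδ
  have h7 := S.cInner_pos
  have h8 : 0 < x ^ γ := rpow_pos_of_pos hx _
  have h9 : 0 ≤ (x / 2) ^ (-ρ) := rpow_nonneg (by linarith) _
  have h10 : ∫ y in Ioc 0 δ, innerInt K g x y * g y
      ≤ cInner γ C ρ * x ^ γ * ((x / 2) ^ (-ρ) * δ ^ (1 - ρ)) := by
    refine h1.2.trans ?_
    have : 0 ≤ ∫ y in Ioc 0 δ, g y :=
      setIntegral_nonneg measurableSet_Ioc fun y _ => hg.nonneg y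
    gcongr
  rw [e1, abs_le]
  have e2 : cInner γ C ρ * x ^ γ * ((x / 2) ^ (-ρ) + 2 ^ κ * M * wt ρ κ x / (1 - ρ)) * δ ^ (1 - ρ)
      = cInner γ C ρ * x ^ γ * ((x / 2) ^ (-ρ) * δ ^ (1 - ρ))
        + cInner γ C ρ * x ^ γ * (2 ^ κ * M * wt ρ κ x * (δ ^ (1 - ρ) / (1 - ρ))) := by ring
  rw [e2]
  constructor <;> linarith [h2.2]

end Setting
/-- Convergence of densities against all test functions `φ` with `φ (x^{-ρ} + x^{-κ})`
integrable. -/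
def WeakLim (ρ κ : ℝ) (u : ℕ → ℝ → ℝ) (g : ℝ → ℝ) : Prop :=
  ∀ φ : ℝ → ℝ, Measurable φ → IntegrableOn (fun x => φ x * wt ρ κ x) (Ioi 0) →
    Tendsto (fun n => ∫ x in Ioi 0, φ x * u n x) atTop (𝓝 (∫ x in Ioi 0, φ x * g x))

lemma tendsto_of_approx {ι : Type*} {l : Filter ι} [l.NeBot] {a : ℕ → ℝ} {A : ℝ}
    {b : ι → ℕ → ℝ} {B e : ι → ℝ} (hb : ∀ᶠ k in l, Tendsto (b k) atTop (𝓝 (B k)))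
    (hab : ∀ᶠ k in l, ∀ᶠ n in atTop, |a n - b k n| ≤ e k)
    (hAB : ∀ᶠ k in l, |A - B k| ≤ e k) (he : Tendsto e l (𝓝 0)) :
    Tendsto a atTop (𝓝 A) := by
  rw [Metric.tendsto_nhds]
  intro ε hε
  have h1 : ∀ᶠ k in l, e k < ε / 3 := he.eventually (gt_mem_nhds (by positivity))
  obtain ⟨k, hk1, hk2, hk3, hk4⟩ := (h1.and (hb.and (hab.and hAB))).exists
  have h2 := Metric.tendsto_nhds.1 hk2 (ε / 3) (by positivity)
  filter_upwards [h2, hk3] with n h3 h4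
  rw [Real.dist_eq] at h3 ⊢
  rw [abs_lt] at h3 ⊢
  rw [abs_le] at h4 hk4
  constructor <;> linarith [h3.1, h3.2, h4.1, h4.2, hk4.1, hk4.2]

lemma Adm.integrableOn_mul (hg : Adm ρ κ M g) {φ Ψ : ℝ → ℝ} (hφ : Measurable φ)
    (hΨ : IntegrableOn (fun x => Ψ x * wt ρ κ x) (Ioi 0))
    (hb : ∀ᵐ x ∂volume.restrict (Ioi (0:ℝ)), |φ x| ≤ Ψ x) :
    IntegrableOn (fun x => φ x * g x) (Ioi 0) := by
  refine Integrable.mono' (hΨ.const_mul M) (hφ.mul hg.meas).aestronglyMeasurable ?_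
  filter_upwards [hb, ae_restrict_mem measurableSet_Ioi] with x h1 hx
  rw [Real.norm_eq_abs, abs_mul, abs_of_nonneg (hg.nonneg x)]
  calc _ ≤ Ψ x * (M * wt ρ κ x) :=
        mul_le_mul h1 (hg.le x hx) (hg.nonneg x) ((abs_nonneg _).trans h1)
    _ = _ := by ring

lemma WeakLim.tendsto_integral (hw : WeakLim ρ κ u g) (hu : ∀ n, Adm ρ κ M (u n))
    {φ : ℕ → ℝ → ℝ} {φ' Ψ : ℝ → ℝ} (hφ : ∀ n, Measurable (φ n)) (hφ' : Measurable φ')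
    (hΨ : IntegrableOn (fun x => Ψ x * wt ρ κ x) (Ioi 0))
    (hb : ∀ᶠ n in atTop, ∀ᵐ x ∂volume.restrict (Ioi (0:ℝ)), |φ n x| ≤ Ψ x)
    (hlim : ∀ᵐ x ∂volume.restrict (Ioi (0:ℝ)), Tendsto (fun n => φ n x) atTop (𝓝 (φ' x))) :
    Tendsto (fun n => ∫ x in Ioi 0, φ n x * u n x) atTop (𝓝 (∫ x in Ioi 0, φ' x * g x)) := by
  have hM := (hu 0).M_nonneg
  have hb' : ∀ᵐ x ∂volume.restrict (Ioi (0:ℝ)), |φ' x| ≤ Ψ x := by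
    obtain ⟨N, hN⟩ := eventually_atTop.1 hb
    have : ∀ᵐ x ∂volume.restrict (Ioi (0:ℝ)), ∀ n, N ≤ n → |φ n x| ≤ Ψ x := by
      rw [ae_all_iff]
      intro n
      by_cases h : N ≤ n
      · filter_upwards [hN n h] with x hx _ using hx
      · exact Eventually.of_forall fun x h' => absurd h' h
    filter_upwards [this, hlim] with x h1 h2
    exact le_of_tendsto h2.abs (eventually_atTop.2 ⟨N, fun n hn => h1 n hn⟩)
  have hφ'i : IntegrableOn (fun x => φ' x * wt ρ κ x) (Ioi 0) := by
    refine Integrable.mono' hΨ (hφ'.mul measurable_wt).aestronglyMeasurable ?_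
    filter_upwards [hb', ae_restrict_mem measurableSet_Ioi] with x h1 hx
    have := wt_pos (ρ := ρ) (κ := κ) hx
    rw [Real.norm_eq_abs, abs_mul, abs_of_pos this]
    gcongr
  have h1 := hw φ' hφ' hφ'i
  have h2 : Tendsto (fun n => ∫ x in Ioi 0, |φ n x - φ' x| * (M * wt ρ κ x)) atTop (𝓝 0) := by
    have : Tendsto (fun n => ∫ x in Ioi 0, |φ n x - φ' x| * (M * wt ρ κ x)) atTop
        (𝓝 (∫ x in Ioi (0:ℝ), (0:ℝ))) := by
      refine tendsto_integral_filter_of_dominated_convergence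
        (fun x => (2 * M) * (Ψ x * wt ρ κ x)) ?_ ?_ (hΨ.const_mul _) ?_
      · refine Eventually.of_forall fun n => Measurable.aestronglyMeasurable ?_
        have := hφ n
        have := measurable_wt (ρ := ρ) (κ := κ)
        fun_prop
      · filter_upwards [hb] with n hn
        filter_upwards [hn, hb', ae_restrict_mem measurableSet_Ioi] with x h1 h2 hx
        have := wt_pos (ρ := ρ) (κ := κ) hx
        rw [Real.norm_eq_abs, abs_of_nonneg (by positivity)]
        calc _ ≤ (Ψ x + Ψ x) * (M * wt ρ κ x) := by
              gcongr; exact (abs_sub _ _).trans (add_le_add h1 h2)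
          _ = _ := by ring
      · filter_upwards [hlim] with x hx
        have : Tendsto (fun n => |φ n x - φ' x| * (M * wt ρ κ x)) atTop
            (𝓝 (|φ' x - φ' x| * (M * wt ρ κ x))) := (hx.sub_const _).abs.mul_const _
        simpa using this
    simpa using this
  have h3 : Tendsto (fun n => ∫ x in Ioi 0, (φ n x - φ' x) * u n x) atTop (𝓝 0) := by
    refine squeeze_zero_norm' ?_ h2
    filter_upwards [hb] with n hn
    refine norm_integral_le_of_norm_le ?_ ?_
    · have : IntegrableOn (fun x => (2 * M) * (Ψ x * wt ρ κ x)) (Ioi 0) := hΨ.const_mul _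
      refine Integrable.mono' this (Measurable.aestronglyMeasurable ?_) ?_
      · have := hφ n
        have := measurable_wt (ρ := ρ) (κ := κ)
        fun_prop
      · filter_upwards [hn, hb', ae_restrict_mem measurableSet_Ioi] with x h1 h2 hx
        have := wt_pos (ρ := ρ) (κ := κ) hx
        rw [Real.norm_eq_abs, abs_of_nonneg (by positivity)]
        calc _ ≤ (Ψ x + Ψ x) * (M * wt ρ κ x) := by
              gcongr; exact (abs_sub _ _).trans (add_le_add h1 h2)
          _ = _ := by ring
    · filter_upwards [ae_restrict_mem measurableSet_Ioi] with x hx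
      rw [Real.norm_eq_abs, abs_mul, abs_of_nonneg ((hu n).nonneg x)]
      gcongr
      exact (hu n).le x hx
  have h4 := h3.add h1
  rw [zero_add] at h4
  refine h4.congr' ?_
  filter_upwards [hb] with n hn
  have i1 := (hu n).integrableOn_mul (hφ n) hΨ hn
  have i2 := (hu n).integrableOn_mul hφ' hΨ hb'
  have : ∀ x, (φ n x - φ' x) * u n x = φ n x * u n x - φ' x * u n x := fun x => sub_mul _ _ _
  simp_rw [this]
  rw [integral_sub i1 i2, sub_add_cancel]

lemma tendsto_indicator_of_mem_iff {φ : ℝ → ℝ} {s : ℕ → Set ℝ} {t : Set ℝ} {z : ℝ}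
    (h : ∀ᶠ n in atTop, (z ∈ s n ↔ z ∈ t)) :
    Tendsto (fun n => (s n).indicator φ z) atTop (𝓝 (t.indicator φ z)) := by
  refine tendsto_const_nhds.congr' ?_
  filter_upwards [h] with n hn
  by_cases hz : z ∈ t
  · rw [indicator_of_mem hz, indicator_of_mem (hn.2 hz)]
  · rw [indicator_of_notMem hz, indicator_of_notMem fun h => hz (hn.1 h)]

lemma innerInt_eq {x y : ℝ} (hyx : y ≤ x) : innerInt K g x y =
    ∫ z in Ioi 0, (Ioi (x - y)).indicator (fun z => K y z / z) z * g z := by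
  simp_rw [← indicator_mul_left]
  rw [setIntegral_indicator measurableSet_Ioi,
    inter_eq_right.2 (Ioi_subset_Ioi (sub_nonneg.2 hyx))]
  rfl

namespace Setting
variable (S : Setting K γ C ρ β κ)
include S

lemma integrableOn_kernel_wt {y r : ℝ} (hy : 0 < y) (hr : 0 < r) :
    IntegrableOn (fun z => K y z / z * wt ρ κ z) (Ioi r) := by
  have h1 := S.gamma_lt; have h2 := S.rho_lt; have h3 := S.rho_pos
  have hκ := S.rho_le
  have hK := S.measurable_kernel y
  have hw := measurable_wt (ρ := ρ) (κ := κ)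
  have i1 := integrableOn_Ioi_rpow_of_lt (a := -1 - ρ) (by linarith) hr
  have i2 := integrableOn_Ioi_rpow_of_lt (a := -1 - κ) (by linarith) hr
  have i3 := integrableOn_Ioi_rpow_of_lt (a := γ - 1 - ρ) (by linarith) hr
  have i4 := integrableOn_Ioi_rpow_of_lt (a := γ - 1 - κ) (by linarith) hr
  refine Integrable.mono' ((((i1.add i2).const_mul (y ^ γ)).add (i3.add i4)).const_mul C)
    (by fun_prop) ?_
  filter_upwards [ae_restrict_mem measurableSet_Ioi] with z hz
  have hz0 : 0 < z := hr.trans hz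
  have hk := S.nonneg y z
  have := wt_pos (ρ := ρ) (κ := κ) hz0
  rw [Real.norm_eq_abs, abs_of_nonneg (by positivity)]
  calc _ ≤ C * (y ^ γ * z ^ (-1 : ℝ) + z ^ (γ - 1)) * wt ρ κ z := by
        gcongr; exact S.kernel_div_le hy hz0
    _ = _ := by
      simp only [Pi.add_apply, wt, sub_eq_add_neg _ ρ, sub_eq_add_neg _ κ, rpow_add hz0 _ (-ρ),
        rpow_add hz0 _ (-κ)]
      ring

lemma tendsto_innerInt (hw : WeakLim ρ κ u g) (hu : ∀ n, Adm ρ κ M (u n))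
    {x : ℕ → ℝ} {x' y : ℝ} (hx : Tendsto x atTop (𝓝 x')) (hy : 0 < y) (hyx : y < x') :
    Tendsto (fun n => innerInt K (u n) (x n) y) atTop (𝓝 (innerInt K g x' y)) := by
  have hev : ∀ᶠ n in atTop, y + (x' - y) / 2 < x n := hx.eventually (lt_mem_nhds (by linarith))
  rw [innerInt_eq hyx.le]
  have hK := S.measurable_kernel y
  have hm : ∀ a, Measurable ((Ioi a).indicator fun z => K y z / z) := fun a =>
    Measurable.indicator (by fun_prop) measurableSet_Ioi
  have key := hw.tendsto_integral hu
    (φ := fun n => (Ioi (x n - y)).indicator fun z => K y z / z)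
    (φ' := (Ioi (x' - y)).indicator fun z => K y z / z)
    (Ψ := (Ioi ((x' - y) / 2)).indicator fun z => K y z / z)
    (fun n => hm _) (hm _) ?_ ?_ ?_
  · refine key.congr' ?_
    filter_upwards [hev] with n hn
    rw [innerInt_eq (by linarith)]
  · simp_rw [← indicator_mul_left]
    rw [IntegrableOn, integrable_indicator_iff measurableSet_Ioi, IntegrableOn,
      Measure.restrict_restrict measurableSet_Ioi]
    exact (S.integrableOn_kernel_wt hy (by linarith : 0 < (x' - y) / 2)).mono_set inter_subset_left
  · filter_upwards [hev] with n hn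
    filter_upwards [ae_restrict_mem measurableSet_Ioi] with z hz
    have hz0 : 0 < z := hz
    have := S.nonneg y z
    have hk : 0 ≤ K y z / z := by positivity
    rw [abs_of_nonneg (indicator_apply_nonneg (f := fun z => K y z / z) (fun _ => hk))]
    by_cases h : z ∈ Ioi (x n - y)
    · have h' : z ∈ Ioi ((x' - y) / 2) := by rw [mem_Ioi] at h ⊢; linarith
      rw [indicator_of_mem h, indicator_of_mem h']
    · rw [indicator_of_notMem h]
      exact indicator_apply_nonneg (f := fun z => K y z / z) (fun _ => hk)
  · have hne : ∀ᵐ z ∂volume.restrict (Ioi (0:ℝ)), z ≠ x' - y :=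
      ae_restrict_of_ae (Measure.ae_ne volume _)
    filter_upwards [hne] with z hz
    apply tendsto_indicator_of_mem_iff
    have hx2 : Tendsto (fun n => x n - y) atTop (𝓝 (x' - y)) := hx.sub_const y
    rcases lt_or_gt_of_ne hz with h | h
    · filter_upwards [hx2.eventually (lt_mem_nhds h)] with n hn
      simp only [mem_Ioi]
      constructor <;> intro <;> linarith
    · filter_upwards [hx2.eventually (gt_mem_nhds h)] with n hn
      simp only [mem_Ioi]
      constructor <;> intro <;> linarith

end Setting
lemma weakLim_const : WeakLim ρ κ (fun _ => g) g := fun _ _ _ => tendsto_const_nhds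

namespace Setting
variable (S : Setting K γ C ρ β κ)
include S

lemma tendsto_setIntegral_core (hw : WeakLim ρ κ u g) (hu : ∀ n, Adm ρ κ M (u n))
    {x : ℕ → ℝ} {x' δ : ℝ} (hx : Tendsto x atTop (𝓝 x')) (hx' : 0 < x') (hδ : 0 < δ)
    (hg : Adm ρ κ M g) :
    Tendsto (fun n => ∫ y in Ioc δ (x n - δ), innerInt K (u n) (x n) y * u n y) atTop
      (𝓝 (∫ y in Ioc δ (x' - δ), innerInt K g x' y * g y)) := by
  have e : ∀ (v : ℝ → ℝ) (a : ℝ), ∫ y in Ioc δ (a - δ), innerInt K v a y * v y =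
      ∫ y in Ioi 0, (Ioc δ (a - δ)).indicator (innerInt K v a) y * v y := by
    intro v a
    simp_rw [← indicator_mul_left]
    rw [setIntegral_indicator measurableSet_Ioc, inter_eq_right.2]
    exact fun y hy => hδ.trans hy.1
  simp_rw [e]
  have hc := S.cInner_pos
  have hγ := S.gamma_nonneg
  have hev : ∀ᶠ n in atTop, x n ≤ 2 * x' := hx.eventually (ge_mem_nhds (by linarith))
  refine hw.tendsto_integral hu
    (Ψ := (Ioc δ (2 * x')).indicator fun _ => cInner γ C ρ * (2 * x') ^ γ * δ ^ (-ρ))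
    (fun n => (S.measurable_innerInt (hu n).meas _).indicator measurableSet_Ioc)
    ((S.measurable_innerInt hg.meas _).indicator measurableSet_Ioc) ?_ ?_ ?_
  · simp_rw [← indicator_mul_left]
    rw [IntegrableOn, integrable_indicator_iff measurableSet_Ioc, IntegrableOn,
      Measure.restrict_restrict measurableSet_Ioc]
    refine (IntegrableOn.mono_set ?_ inter_subset_left)
    refine IntegrableOn.mono_set (t := Icc δ (2 * x')) ?_ Ioc_subset_Icc_self
    refine ContinuousOn.integrableOn_Icc (continuousOn_const.mul (continuousOn_wt.mono ?_))
    exact fun y hy => hδ.trans_le hy.1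
  · filter_upwards [hev] with n hn
    refine Eventually.of_forall fun y => ?_
    by_cases h : y ∈ Ioc δ (x n - δ)
    · have h' : y ∈ Ioc δ (2 * x') := ⟨h.1, by linarith [h.2]⟩
      have hy : 0 < y := hδ.trans h.1
      rw [indicator_of_mem h, indicator_of_mem h',
        abs_of_nonneg (S.innerInt_nonneg (hu n).nonneg (by linarith [h.2]))]
      have hxn : 0 < x n := by linarith [h.2, h.1]
      have h1 : x n ^ γ ≤ (2 * x') ^ γ := rpow_le_rpow hxn.le hn hγ
      have h2 : (x n - y) ^ (-ρ) ≤ δ ^ (-ρ) :=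
        rpow_le_rpow_of_nonpos hδ (by linarith [h.2]) (by linarith [S.rho_pos])
      have h3 : 0 ≤ x n ^ γ := rpow_nonneg hxn.le _
      have h4 : 0 ≤ (x n - y) ^ (-ρ) := rpow_nonneg (by linarith [h.2]) _
      refine (S.innerInt_le (hu n) hy (by linarith [h.2])).trans ?_
      gcongr
    · rw [indicator_of_notMem h, abs_zero]
      exact indicator_apply_nonneg fun _ => by positivity
  · have hne : ∀ᵐ z ∂volume.restrict (Ioi (0:ℝ)), z ≠ x' - δ :=
      ae_restrict_of_ae (Measure.ae_ne volume _)
    filter_upwards [hne] with y hy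
    have hx2 : Tendsto (fun n => x n - δ) atTop (𝓝 (x' - δ)) := hx.sub_const δ
    by_cases h : y ∈ Ioc δ (x' - δ)
    · rw [indicator_of_mem h]
      have hlt := lt_of_le_of_ne h.2 hy
      refine (S.tendsto_innerInt hw hu hx (hδ.trans h.1) (by linarith)).congr' ?_
      filter_upwards [hx2.eventually (lt_mem_nhds hlt)] with n hn
      rw [indicator_of_mem (show y ∈ Ioc δ (x n - δ) from ⟨h.1, hn.le⟩)]
    · rw [indicator_of_notMem h]
      refine tendsto_const_nhds.congr' ?_
      by_cases h1 : δ < y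
      · have h2 : x' - δ < y := not_le.1 fun h' => h ⟨h1, h'⟩
        filter_upwards [hx2.eventually (gt_mem_nhds h2)] with n hn
        rw [indicator_of_notMem fun h => hn.not_ge h.2]
      · exact Eventually.of_forall fun n => (indicator_of_notMem (fun h => h1 h.1) _).symm

lemma tendsto_Ifun (hw : WeakLim ρ κ u g) (hu : ∀ n, Adm ρ κ M (u n)) (hg : Adm ρ κ M g)
    {x : ℕ → ℝ} {x' : ℝ} (hx : Tendsto x atTop (𝓝 x')) (hx' : 0 < x') :
    Tendsto (fun n => Ifun K (u n) (x n)) atTop (𝓝 (Ifun K g x')) := by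
  have hc := S.cInner_pos
  have hγ := S.gamma_nonneg
  have hρ := S.rho_lt
  have hM := hg.M_nonneg
  set D := cInner γ C ρ * (2 * x') ^ γ *
    ((x' / 4) ^ (-ρ) + 2 ^ κ * M * wt ρ κ (x' / 2) / (1 - ρ)) with hD
  have hev : ∀ᶠ n in atTop, x n ≤ 2 * x' ∧ x' / 2 ≤ x n :=
    (hx.eventually (ge_mem_nhds (by linarith))).and (hx.eventually (le_mem_nhds (by linarith)))
  have hsmall : ∀ᶠ δ in 𝓝[>] (0:ℝ), 0 < δ ∧ δ ≤ x' / 4 := by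
    refine eventually_mem_nhdsWithin.and ?_
    exact eventually_nhdsWithin_of_eventually_nhds (ge_mem_nhds (by linarith))
  have hbd : ∀ v, Adm ρ κ M v → ∀ a δ, a ≤ 2 * x' → x' / 2 ≤ a → 0 < δ → δ ≤ x' / 4 →
      |Ifun K v a - ∫ y in Ioc δ (a - δ), innerInt K v a y * v y| ≤ D * δ ^ (1 - ρ) := by
    intro v hv a δ h1 h2 h3 h4
    refine (S.abs_Ifun_sub_le hv h3 (by linarith)).trans ?_
    have h5 : a ^ γ ≤ (2 * x') ^ γ := rpow_le_rpow (by linarith) h1 hγ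
    have h6 : (a / 2) ^ (-ρ) ≤ (x' / 4) ^ (-ρ) :=
      rpow_le_rpow_of_nonpos (by linarith) (by linarith) (by linarith [S.rho_pos])
    have h7 : wt ρ κ a ≤ wt ρ κ (x' / 2) :=
      wt_anti S.rho_pos.le S.kappa_pos.le (by linarith) h2
    have h8 : 0 < 1 - ρ := by linarith
    have h9 := wt_pos (ρ := ρ) (κ := κ) (x := a) (by linarith)
    have h10 : 0 ≤ (a / 2) ^ (-ρ) := rpow_nonneg (by linarith) _
    rw [hD]
    gcongr
  refine tendsto_of_approx (l := 𝓝[>] (0:ℝ)) (e := fun δ => D * δ ^ (1 - ρ))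
    (b := fun δ n => ∫ y in Ioc δ (x n - δ), innerInt K (u n) (x n) y * u n y)
    (B := fun δ => ∫ y in Ioc δ (x' - δ), innerInt K g x' y * g y) ?_ ?_ ?_ ?_
  · filter_upwards [hsmall] with δ hδ
    exact S.tendsto_setIntegral_core hw hu hx hx' hδ.1 hg
  · filter_upwards [hsmall] with δ hδ
    filter_upwards [hev] with n hn
    exact hbd _ (hu n) _ _ hn.1 hn.2 hδ.1 hδ.2
  · filter_upwards [hsmall] with δ hδ
    exact hbd _ hg _ _ (by linarith) (by linarith) hδ.1 hδ.2
  · have h1 : ContinuousAt (fun δ : ℝ => D * δ ^ (1 - ρ)) 0 :=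
      continuousAt_const.mul (continuousAt_rpow_const _ _ (Or.inr (by linarith)))
    have h2 := h1.tendsto
    rw [zero_rpow (by linarith), mul_zero] at h2
    exact h2.mono_left nhdsWithin_le_nhds

lemma continuousOn_Ifun (hg : Adm ρ κ M g) : ContinuousOn (Ifun K g) (Ioi 0) := by
  intro x hx
  refine ContinuousAt.continuousWithinAt ?_
  refine tendsto_of_seq_tendsto fun s hs => ?_
  exact S.tendsto_Ifun weakLim_const (fun _ => hg) hg hs hx

end Setting

/-- The function `J(x) = β⁻¹ ∫_x^∞ I[g](s) s^{ρ-2} ds`. -/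
def tailJ (K : ℝ → ℝ → ℝ) (ρ β : ℝ) (g : ℝ → ℝ) (x : ℝ) : ℝ :=
  β⁻¹ * ∫ s in Ioi x, Ifun K g s * s ^ (ρ - 2)

lemma integrableOn_rpow_wt (hγρ : γ < ρ) (hκ : ρ ≤ κ) {x : ℝ} (hx : 0 < x) :
    IntegrableOn (fun s => s ^ (γ - 1) * wt ρ κ s) (Ioi x) := by
  have i3 := integrableOn_Ioi_rpow_of_lt (a := γ - 1 - ρ) (by linarith) hx
  have i4 := integrableOn_Ioi_rpow_of_lt (a := γ - 1 - κ) (by linarith) hx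
  refine (i3.add i4).congr ?_
  filter_upwards [ae_restrict_mem measurableSet_Ioi] with s hs
  have hs0 : 0 < s := hx.trans hs
  simp only [Pi.add_apply, wt, sub_eq_add_neg _ ρ, sub_eq_add_neg _ κ, rpow_add hs0 _ (-ρ),
        rpow_add hs0 _ (-κ)]
  ring

namespace Setting
variable (S : Setting K γ C ρ β κ)
include S

lemma Ifun_mul_rpow_le (hg : Adm ρ κ M g) {s : ℝ} (hs : 0 < s) :
    Ifun K g s * s ^ (ρ - 2) ≤ cOuter γ C ρ κ M * (s ^ (γ - 1) * wt ρ κ s) := by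
  have h1 := S.Ifun_le_wt hg hs
  have h2 : s ^ (γ - 1) = s ^ (1 + γ - ρ) * s ^ (ρ - 2) := by
    rw [← rpow_add hs]; congr 1; ring
  have h3 := mul_le_mul_of_nonneg_right h1 (rpow_nonneg hs.le (ρ - 2))
  rw [h2]
  linarith

lemma Ifun_mul_rpow_nonneg (hg : Adm ρ κ M g) {s : ℝ} (hs : 0 < s) :
    0 ≤ Ifun K g s * s ^ (ρ - 2) :=
  mul_nonneg (S.Ifun_nonneg hg.nonneg s) (rpow_nonneg hs.le _)

lemma continuousOn_Ifun_mul_rpow (hg : Adm ρ κ M g) :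
    ContinuousOn (fun s => Ifun K g s * s ^ (ρ - 2)) (Ioi 0) :=
  (S.continuousOn_Ifun hg).mul fun _ hx =>
    (continuousAt_rpow_const _ _ (Or.inl (ne_of_gt hx))).continuousWithinAt

lemma integrableOn_Ifun_mul_rpow (hg : Adm ρ κ M g) {x : ℝ} (hx : 0 < x) :
    IntegrableOn (fun s => Ifun K g s * s ^ (ρ - 2)) (Ioi x) := by
  refine Integrable.mono'
    ((integrableOn_rpow_wt S.gamma_lt S.rho_le hx).const_mul (cOuter γ C ρ κ M))
    (((S.continuousOn_Ifun_mul_rpow hg).mono (Ioi_subset_Ioi hx.le)).aestronglyMeasurable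
      measurableSet_Ioi) ?_
  filter_upwards [ae_restrict_mem measurableSet_Ioi] with s hs
  have hs0 : 0 < s := hx.trans hs
  rw [Real.norm_eq_abs, abs_of_nonneg (S.Ifun_mul_rpow_nonneg hg hs0)]
  exact S.Ifun_mul_rpow_le hg hs0

lemma tailJ_nonneg (hg : Adm ρ κ M g) {x : ℝ} (hx : 0 < x) : 0 ≤ tailJ K ρ β g x :=
  mul_nonneg (inv_nonneg.2 S.beta_pos.le) (setIntegral_nonneg measurableSet_Ioi fun _ hs =>
    S.Ifun_mul_rpow_nonneg hg (hx.trans hs))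

lemma tailJ_eq_sub (hg : Adm ρ κ M g) {a x : ℝ} (ha : 0 < a) (hax : a ≤ x) :
    tailJ K ρ β g x = tailJ K ρ β g a - β⁻¹ * ∫ s in a..x, Ifun K g s * s ^ (ρ - 2) := by
  have h := S.integrableOn_Ifun_mul_rpow hg ha
  unfold tailJ
  rw [intervalIntegral.integral_of_le hax, ← Ioc_union_Ioi_eq_Ioi hax,
    setIntegral_union Ioc_disjoint_Ioi_same measurableSet_Ioi (h.mono_set Ioc_subset_Ioi_self)
      (h.mono_set (Ioi_subset_Ioi hax))]
  ring

lemma hasDerivAt_tailJ (hg : Adm ρ κ M g) {x : ℝ} (hx : 0 < x) :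
    HasDerivAt (tailJ K ρ β g) (-(β⁻¹ * (Ifun K g x * x ^ (ρ - 2)))) x := by
  have hc := S.continuousOn_Ifun_mul_rpow hg
  have ha : 0 < x / 2 := half_pos hx
  have h1 : HasDerivAt (fun t => ∫ s in (x / 2)..t, Ifun K g s * s ^ (ρ - 2))
      (Ifun K g x * x ^ (ρ - 2)) x := by
    refine intervalIntegral.integral_hasDerivAt_right ?_ ?_ (hc.continuousAt (Ioi_mem_nhds hx))
    · refine ContinuousOn.intervalIntegrable (hc.mono fun y hy => ?_)
      rw [uIcc_of_le (by linarith)] at hy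
      exact ha.trans_le hy.1
    · exact hc.stronglyMeasurableAtFilter isOpen_Ioi x hx
  have h2 := (h1.const_mul β⁻¹).const_sub (tailJ K ρ β g (x / 2))
  refine h2.congr_of_eventuallyEq ?_
  filter_upwards [Ioi_mem_nhds (half_lt_self hx)] with t ht
  exact S.tailJ_eq_sub hg ha (le_of_lt ht)

lemma continuousOn_tailJ (hg : Adm ρ κ M g) : ContinuousOn (tailJ K ρ β g) (Ioi 0) :=
  fun _ hx => (S.hasDerivAt_tailJ hg hx).continuousAt.continuousWithinAt

lemma tailJ_antitoneOn (hg : Adm ρ κ M g) : AntitoneOn (tailJ K ρ β g) (Ioi 0) := by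
  intro x hx y _ hxy
  rw [S.tailJ_eq_sub hg hx hxy]
  have : 0 ≤ ∫ s in x..y, Ifun K g s * s ^ (ρ - 2) :=
    intervalIntegral.integral_nonneg hxy fun s hs =>
      S.Ifun_mul_rpow_nonneg hg (lt_of_lt_of_le hx hs.1)
  have := mul_nonneg (inv_nonneg.2 S.beta_pos.le) this
  linarith

lemma tendsto_tailJ_atTop (hg : Adm ρ κ M g) : Tendsto (tailJ K ρ β g) atTop (𝓝 0) := by
  have h := intervalIntegral_tendsto_integral_Ioi 1 (S.integrableOn_Ifun_mul_rpow hg one_pos)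
    tendsto_id
  have h2 := (h.const_mul β⁻¹).const_sub (tailJ K ρ β g 1)
  have h3 : tailJ K ρ β g 1 - β⁻¹ * ∫ s in Ioi 1, Ifun K g s * s ^ (ρ - 2) = 0 := sub_self _
  rw [h3] at h2
  refine h2.congr' ?_
  filter_upwards [eventually_ge_atTop 1] with x hx
  exact (S.tailJ_eq_sub hg one_pos hx).symm

lemma tendsto_tailJ (hw : WeakLim ρ κ u g) (hu : ∀ n, Adm ρ κ M (u n)) (hg : Adm ρ κ M g)
    {x : ℝ} (hx : 0 < x) :
    Tendsto (fun n => tailJ K ρ β (u n) x) atTop (𝓝 (tailJ K ρ β g x)) := by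
  refine Tendsto.const_mul _ ?_
  refine tendsto_integral_of_dominated_convergence
    (fun s => cOuter γ C ρ κ M * (s ^ (γ - 1) * wt ρ κ s))
    (fun n => (S.integrableOn_Ifun_mul_rpow (hu n) hx).aestronglyMeasurable)
    ((integrableOn_rpow_wt S.gamma_lt S.rho_le hx).const_mul _) (fun n => ?_) ?_
  · filter_upwards [ae_restrict_mem measurableSet_Ioi] with s hs
    have hs0 : 0 < s := hx.trans hs
    rw [Real.norm_eq_abs, abs_of_nonneg (S.Ifun_mul_rpow_nonneg (hu n) hs0)]
    exact S.Ifun_mul_rpow_le (hu n) hs0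
  · filter_upwards [ae_restrict_mem measurableSet_Ioi] with s hs
    exact (S.tendsto_Ifun hw hu hg tendsto_const_nhds (hx.trans hs)).mul_const _

end Setting
/-- The derivative of `x^{1-ρ} (1 - J(x))`. -/
def flux (K : ℝ → ℝ → ℝ) (ρ β : ℝ) (g : ℝ → ℝ) (x : ℝ) : ℝ :=
  x⁻¹ * ((1 - ρ) * x ^ (1 - ρ) * (1 - tailJ K ρ β g x) + β⁻¹ * Ifun K g x)

/-- The fixed point map: the derivative of `x^{1-ρ} (1 - J(x))_+`. -/
def profileMap (K : ℝ → ℝ → ℝ) (ρ β : ℝ) (g : ℝ → ℝ) : ℝ → ℝ :=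
  {x | 0 < x ∧ tailJ K ρ β g x < 1}.indicator (flux K ρ β g)

/-- The function `x^{1-ρ} (1 - J(x))_+`. -/
def cumulative (K : ℝ → ℝ → ℝ) (ρ β : ℝ) (g : ℝ → ℝ) (x : ℝ) : ℝ :=
  x ^ (1 - ρ) * max 0 (1 - tailJ K ρ β g x)

lemma profileMap_of_lt {x : ℝ} (hx : 0 < x) (hJ : tailJ K ρ β g x < 1) :
    profileMap K ρ β g x = flux K ρ β g x := 
  indicator_of_mem (show x ∈ {x | 0 < x ∧ tailJ K ρ β g x < 1} from ⟨hx, hJ⟩) _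

lemma profileMap_of_le {x : ℝ} (hJ : 1 ≤ tailJ K ρ β g x) : profileMap K ρ β g x = 0 :=
  indicator_of_notMem (fun h => hJ.not_gt h.2) _

lemma exists_pos_mul_rpow_le (hρ : ρ < 1) (D : ℝ) :
    ∃ c : ℝ, 0 < c ∧ c ≤ 1 / 2 ∧ D * c ^ (1 - ρ) ≤ 1 / 2 := by
  have h1 : ContinuousAt (fun δ : ℝ => D * δ ^ (1 - ρ)) 0 :=
    continuousAt_const.mul (continuousAt_rpow_const _ _ (Or.inr (by linarith)))
  have h2 := h1.tendsto
  rw [zero_rpow (by linarith), mul_zero] at h2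
  have h3 : ∀ᶠ c in 𝓝[>] (0:ℝ), D * c ^ (1 - ρ) ≤ 1 / 2 :=
    (h2.mono_left nhdsWithin_le_nhds).eventually (ge_mem_nhds (by norm_num))
  have h4 : ∀ᶠ c in 𝓝[>] (0:ℝ), c ≤ 1 / 2 :=
    eventually_nhdsWithin_of_eventually_nhds (ge_mem_nhds (by norm_num))
  have h5 : ∀ᶠ c in 𝓝[>] (0:ℝ), 0 < c := eventually_mem_nhdsWithin
  obtain ⟨c, h⟩ := (h5.and (h4.and h3)).exists
  exact ⟨c, h⟩

namespace Setting
variable (S : Setting K γ C ρ β κ)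
include S

lemma flux_nonneg (hg : ∀ z, 0 ≤ g z) {x : ℝ} (hx : 0 < x) (hJ : tailJ K ρ β g x ≤ 1) :
    0 ≤ flux K ρ β g x := by
  have h1 := S.Ifun_nonneg hg x
  have h2 : 0 ≤ 1 - ρ := by linarith [S.rho_lt]
  have h3 : 0 ≤ 1 - tailJ K ρ β g x := by linarith
  have h4 := S.beta_pos
  unfold flux; positivity

lemma profileMap_nonneg (hg : ∀ z, 0 ≤ g z) (x : ℝ) : 0 ≤ profileMap K ρ β g x :=
  indicator_apply_nonneg fun h => S.flux_nonneg hg h.1 h.2.le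

lemma continuousOn_flux (hg : Adm ρ κ M g) : ContinuousOn (flux K ρ β g) (Ioi 0) := by
  have h1 := S.continuousOn_Ifun hg
  have h2 := S.continuousOn_tailJ hg
  have h3 : ContinuousOn (fun x : ℝ => x ^ (1 - ρ)) (Ioi 0) := fun x hx =>
    (continuousAt_rpow_const _ _ (Or.inl (ne_of_gt hx))).continuousWithinAt
  have h4 : ContinuousOn (fun x : ℝ => x⁻¹) (Ioi 0) :=
    continuousOn_id.inv₀ fun x hx => ne_of_gt hx
  exact h4.mul (((continuousOn_const.mul h3).mul (continuousOn_const.sub h2)).add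
    (continuousOn_const.mul h1))

lemma measurable_profileMap (hg : Adm ρ κ M g) : Measurable (profileMap K ρ β g) := by
  classical
  have ho : IsOpen {x | 0 < x ∧ tailJ K ρ β g x < 1} :=
    (S.continuousOn_tailJ hg).isOpen_inter_preimage isOpen_Ioi isOpen_Iio
  have h := ContinuousOn.measurable_piecewise (f := flux K ρ β g) (g := fun _ => (0:ℝ))
    ((S.continuousOn_flux hg).mono fun x hx => hx.1) continuousOn_const ho.measurableSet
  have e : profileMap K ρ β g = {x | 0 < x ∧ tailJ K ρ β g x < 1}.piecewise (flux K ρ β g)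
      (fun _ => (0:ℝ)) := (piecewise_eq_indicator).symm
  rw [e]
  exact h

lemma cumulative_le (hg : Adm ρ κ M g) {x : ℝ} (hx : 0 ≤ x) :
    cumulative K ρ β g x ≤ x ^ (1 - ρ) := by
  rcases hx.eq_or_lt with rfl | hx
  · rw [cumulative, zero_rpow (by linarith [S.rho_lt]), zero_mul]
  · have h := S.tailJ_nonneg hg hx
    exact mul_le_of_le_one_right (rpow_nonneg hx.le _) (max_le zero_le_one (by linarith))

omit S in
lemma cumulative_nonneg {x : ℝ} (hx : 0 ≤ x) : 0 ≤ cumulative K ρ β g x :=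
  mul_nonneg (rpow_nonneg hx _) (le_max_left _ _)

lemma continuousOn_cumulative (hg : Adm ρ κ M g) : ContinuousOn (cumulative K ρ β g) (Ici 0) := by
  have hρ : 0 < 1 - ρ := by linarith [S.rho_lt]
  intro x hx
  rcases (show 0 ≤ x from hx).eq_or_lt with rfl | hx
  · have h0 : cumulative K ρ β g 0 = 0 := by rw [cumulative, zero_rpow hρ.ne', zero_mul]
    rw [ContinuousWithinAt, h0]
    have h1 : Tendsto (fun x : ℝ => x ^ (1 - ρ)) (𝓝[Ici 0] 0) (𝓝 0) := by
      have := (continuousAt_rpow_const (0:ℝ) (1 - ρ) (Or.inr hρ.le)).tendsto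
      rw [zero_rpow hρ.ne'] at this
      exact this.mono_left nhdsWithin_le_nhds
    refine tendsto_of_tendsto_of_tendsto_of_le_of_le' tendsto_const_nhds h1 ?_ ?_
    · filter_upwards [self_mem_nhdsWithin] with y hy using cumulative_nonneg hy
    · filter_upwards [self_mem_nhdsWithin] with y hy using S.cumulative_le hg hy
  · refine ContinuousAt.continuousWithinAt ?_
    have h1 := (S.hasDerivAt_tailJ hg hx).continuousAt
    exact (continuousAt_rpow_const _ _ (Or.inl hx.ne')).mul
      (continuousAt_const.max (continuousAt_const.sub h1))

lemma hasDerivAt_cumulative (hg : Adm ρ κ M g) {x : ℝ} (hx : 0 < x) (hJ : tailJ K ρ β g x < 1) :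
    HasDerivAt (cumulative K ρ β g) (flux K ρ β g x) x := by
  have h1 := S.hasDerivAt_tailJ hg hx
  have h2 : HasDerivAt (fun x : ℝ => x ^ (1 - ρ)) ((1 - ρ) * x ^ (1 - ρ - 1)) x :=
    hasDerivAt_rpow_const (Or.inl hx.ne')
  have h3 := h2.mul (h1.const_sub 1)
  have e : (1 - ρ) * x ^ (1 - ρ - 1) * (1 - tailJ K ρ β g x)
      + x ^ (1 - ρ) * (- -(β⁻¹ * (Ifun K g x * x ^ (ρ - 2)))) = flux K ρ β g x := by
    have e1 : x ^ (1 - ρ - 1) = x⁻¹ * x ^ (1 - ρ) := by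
      rw [rpow_sub_one hx.ne', div_eq_inv_mul]
    have e2 : x ^ (1 - ρ) * x ^ (ρ - 2) = x⁻¹ := by
      rw [← rpow_add hx, ← rpow_neg_one]; congr 1; ring
    rw [e1, flux, neg_neg]
    linear_combination (β⁻¹ * Ifun K g x) * e2
  rw [e] at h3
  refine h3.congr_of_eventuallyEq ?_
  filter_upwards [h1.continuousAt.eventually (gt_mem_nhds hJ)] with y hy
  simp only [cumulative, Pi.mul_apply]
  rw [max_eq_right (by linarith)]

lemma profileMap_integral (hg : Adm ρ κ M g) {R : ℝ} (hR : 0 < R) :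
    IntegrableOn (profileMap K ρ β g) (Ioc 0 R) ∧
    ∫ x in Ioc 0 R, profileMap K ρ β g x = cumulative K ρ β g R := by
  have hρ : 0 < 1 - ρ := by linarith [S.rho_lt]
  have hcont : ContinuousOn (cumulative K ρ β g) (Icc 0 R) :=
    (S.continuousOn_cumulative hg).mono fun x hx => hx.1
  have h0 : cumulative K ρ β g 0 = 0 := by rw [cumulative, zero_rpow hρ.ne', zero_mul]
  have hcl : IsCompact (Icc 0 R ∩ cumulative K ρ β g ⁻¹' {0}) :=
    isCompact_Icc.of_isClosed_subset
      (hcont.preimage_isClosed_of_isClosed isClosed_Icc isClosed_singleton) inter_subset_left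
  obtain ⟨a, ⟨⟨ha0, haR⟩, hVa⟩, hmax⟩ := hcl.exists_isGreatest ⟨0, ⟨le_rfl, hR.le⟩, h0⟩
  have hVa : cumulative K ρ β g a = 0 := hVa
  have hlo : ∀ x ∈ Ioc 0 a, profileMap K ρ β g x = 0 := by
    intro x hx
    apply profileMap_of_le
    have ha : 0 < a := hx.1.trans_le hx.2
    have h1 := (mul_eq_zero.1 hVa).resolve_left (rpow_pos_of_pos ha _).ne'
    have h2 : 1 - tailJ K ρ β g a ≤ 0 := by
      rw [← h1]; exact le_max_right _ _
    linarith [S.tailJ_antitoneOn hg hx.1 ha hx.2]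
  have hhi : ∀ x ∈ Ioc a R, tailJ K ρ β g x < 1 := by
    intro x hx
    by_contra hJ
    have : cumulative K ρ β g x = 0 := by
      rw [cumulative, max_eq_left (by linarith), mul_zero]
    exact hx.1.not_ge (hmax ⟨⟨ha0.trans hx.1.le, hx.2⟩, this⟩)
  have hder : ∀ x ∈ Ioo a R, HasDerivAt (cumulative K ρ β g) (profileMap K ρ β g x) x := by
    intro x hx
    have hx0 := ha0.trans_lt hx.1
    have hJ := hhi x ⟨hx.1, hx.2.le⟩
    rw [profileMap_of_lt hx0 hJ]
    exact S.hasDerivAt_cumulative hg hx0 hJ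
  have hcont' : ContinuousOn (cumulative K ρ β g) (Icc a R) :=
    hcont.mono (Icc_subset_Icc_left ha0)
  have i2 : IntegrableOn (profileMap K ρ β g) (Ioc a R) :=
    intervalIntegral.integrableOn_deriv_of_nonneg hcont' hder
      fun x _ => S.profileMap_nonneg hg.nonneg x
  have i1 : IntegrableOn (profileMap K ρ β g) (Ioc 0 a) :=
    integrableOn_zero.congr_fun (fun x hx => (hlo x hx).symm) measurableSet_Ioc
  rw [← Ioc_union_Ioc_eq_Ioc ha0 haR]
  refine ⟨i1.union i2, ?_⟩
  rw [setIntegral_union (Ioc_disjoint_Ioc_of_le le_rfl) measurableSet_Ioc i1 i2,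
    setIntegral_congr_fun measurableSet_Ioc hlo, ← intervalIntegral.integral_of_le haR,
    intervalIntegral.integral_eq_sub_of_hasDerivAt_of_le haR hcont' hder
      ((intervalIntegrable_iff_integrableOn_Ioc_of_le haR).2 i2), hVa]
  simp

lemma profileMap_le (hκ : κ = ρ + ρ * ((1 - γ) / (1 - ρ))) {c : ℝ} (hc : 0 < c) (hc2 : c ≤ 1 / 2)
    (hg : Adm ρ κ M g) {x : ℝ} (hx : 0 < x) :
    profileMap K ρ β g x ≤ ((1 - ρ) + β⁻¹ * cInner γ C ρ * c ^ (-ρ)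
      + β⁻¹ * cInner γ C ρ * 2 ^ κ / (1 - ρ) * c ^ (1 - ρ) * M) * wt ρ κ x := by
  have hγ0 := S.gamma_nonneg
  have hγρ := S.gamma_lt
  have hρ0 := S.rho_pos
  have hρ : 0 < 1 - ρ := by linarith [S.rho_lt]
  have hβ := S.beta_pos
  have hcI := S.cInner_pos
  have hM := hg.M_nonneg
  have hw := wt_pos (ρ := ρ) (κ := κ) hx
  set q := (1 - γ) / (1 - ρ) with hq
  have hq1 : 1 ≤ q := by rw [hq, one_le_div hρ]; linarith
  have hqρ : q * (1 - ρ) = 1 - γ := div_mul_cancel₀ _ hρ.ne'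
  obtain ⟨θ, hθ0, hθx, hθ1, hθ2⟩ : ∃ θ : ℝ, 0 < θ ∧ θ ≤ x / 2 ∧ θ ≤ c * x ^ q ∧
      x ^ (γ - ρ) * θ ^ (-ρ) ≤ c ^ (-ρ) * wt ρ κ x := by
    have hwρ : x ^ (-ρ) ≤ wt ρ κ x := le_add_of_nonneg_right (rpow_nonneg hx.le _)
    have hwκ : x ^ (-κ) ≤ wt ρ κ x := le_add_of_nonneg_left (rpow_nonneg hx.le _)
    rcases le_total 1 x with h1 | h1
    · refine ⟨c * x, by positivity, by nlinarith, ?_, ?_⟩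
      · have : x ^ (1:ℝ) ≤ x ^ q := rpow_le_rpow_of_exponent_le h1 hq1
        rw [rpow_one] at this
        gcongr
      · rw [mul_rpow hc.le hx.le, mul_left_comm, ← rpow_add hx]
        gcongr
        refine le_trans ?_ hwρ
        exact rpow_le_rpow_of_exponent_le h1 (by linarith)
    · refine ⟨c * x ^ q, by positivity, ?_, le_rfl, ?_⟩
      · have : x ^ q ≤ x ^ (1:ℝ) := rpow_le_rpow_of_exponent_ge hx h1 hq1
        rw [rpow_one] at this
        have h3 : 0 ≤ x ^ q := rpow_nonneg hx.le _
        nlinarith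
      · rw [mul_rpow hc.le (rpow_nonneg hx.le _), mul_left_comm, ← rpow_mul hx.le, ← rpow_add hx]
        gcongr
        refine le_trans ?_ hwκ
        refine rpow_le_rpow_of_exponent_ge hx h1 ?_
        rw [hκ]
        linarith [mul_comm q ρ]
  have hI := S.Ifun_le hg hθ0 hθx
  have hJ := S.tailJ_nonneg hg hx
  have hxγ := rpow_pos_of_pos hx (γ - 1)
  have hI2 : x⁻¹ * (β⁻¹ * Ifun K g x) ≤ (β⁻¹ * cInner γ C ρ * c ^ (-ρ)
      + β⁻¹ * cInner γ C ρ * 2 ^ κ / (1 - ρ) * c ^ (1 - ρ) * M) * wt ρ κ x := by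
    have e1 : x⁻¹ * x ^ γ * x ^ (1 - ρ) = x ^ (γ - ρ) := by
      rw [← rpow_neg_one, ← rpow_add hx, ← rpow_add hx]; congr 1; ring
    have e2 : x⁻¹ * x ^ γ * θ ^ (1 - ρ) ≤ c ^ (1 - ρ) := by
      have : θ ^ (1 - ρ) ≤ (c * x ^ q) ^ (1 - ρ) := rpow_le_rpow hθ0.le hθ1 hρ.le
      rw [mul_rpow hc.le (rpow_nonneg hx.le _), ← rpow_mul hx.le, hqρ] at this
      have e3 : x⁻¹ * x ^ γ * x ^ (1 - γ) = 1 := by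
        rw [← rpow_neg_one, ← rpow_add hx, ← rpow_add hx]
        rw [show -1 + γ + (1 - γ) = 0 by ring, rpow_zero]
      calc _ ≤ x⁻¹ * x ^ γ * (c ^ (1 - ρ) * x ^ (1 - γ)) := by gcongr
        _ = c ^ (1 - ρ) * (x⁻¹ * x ^ γ * x ^ (1 - γ)) := by ring
        _ = _ := by rw [e3, mul_one]
    calc _ ≤ x⁻¹ * (β⁻¹ * (cInner γ C ρ * x ^ γ *
        (θ ^ (-ρ) * x ^ (1 - ρ) + 2 ^ κ * M * wt ρ κ x * (θ ^ (1 - ρ) / (1 - ρ))))) := by gcongr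
      _ = β⁻¹ * cInner γ C ρ * ((x⁻¹ * x ^ γ * x ^ (1 - ρ)) * θ ^ (-ρ))
        + β⁻¹ * cInner γ C ρ * 2 ^ κ / (1 - ρ) * (x⁻¹ * x ^ γ * θ ^ (1 - ρ)) * M * wt ρ κ x := by
          ring
      _ ≤ β⁻¹ * cInner γ C ρ * (c ^ (-ρ) * wt ρ κ x)
        + β⁻¹ * cInner γ C ρ * 2 ^ κ / (1 - ρ) * c ^ (1 - ρ) * M * wt ρ κ x := by
          rw [e1]
          gcongr
      _ = _ := by ring
  have hT : x⁻¹ * ((1 - ρ) * x ^ (1 - ρ) * (1 - tailJ K ρ β g x)) ≤ (1 - ρ) * wt ρ κ x := by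
    have e1 : x⁻¹ * x ^ (1 - ρ) = x ^ (-ρ) := by
      rw [← rpow_neg_one, ← rpow_add hx]; congr 1; ring
    have h2 : x ^ (-ρ) ≤ wt ρ κ x := le_add_of_nonneg_right (rpow_nonneg hx.le _)
    have h3 : 0 < x ^ (-ρ) := rpow_pos_of_pos hx _
    calc _ = (1 - ρ) * ((x⁻¹ * x ^ (1 - ρ)) * (1 - tailJ K ρ β g x)) := by ring
      _ ≤ (1 - ρ) * (wt ρ κ x * 1) := by
          rw [e1]
          refine mul_le_mul_of_nonneg_left ?_ hρ.le
          exact (mul_le_mul_of_nonneg_left (by linarith) h3.le).trans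
            (mul_le_mul_of_nonneg_right h2 zero_le_one)
      _ = _ := by ring
  have hI3 : 0 ≤ x⁻¹ * (β⁻¹ * Ifun K g x) := by
    have := S.Ifun_nonneg hg.nonneg x
    positivity
  rw [add_assoc, add_mul]
  by_cases hJ1 : tailJ K ρ β g x < 1
  · rw [profileMap_of_lt hx hJ1, flux, mul_add]
    exact add_le_add hT hI2
  · rw [profileMap_of_le (not_lt.1 hJ1)]
    have : 0 ≤ (1 - ρ) * wt ρ κ x := by positivity
    linarith

lemma exists_adm_profileMap (hκ : κ = ρ + ρ * ((1 - γ) / (1 - ρ))) :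
    ∃ M : ℝ, 0 ≤ M ∧ ∀ g, Adm ρ κ M g → Adm ρ κ M (profileMap K ρ β g) := by
  obtain ⟨c, hc, hc2, hcD⟩ := exists_pos_mul_rpow_le S.rho_lt
    (β⁻¹ * cInner γ C ρ * 2 ^ κ / (1 - ρ))
  have hρ : 0 < 1 - ρ := by linarith [S.rho_lt]
  have hβ := S.beta_pos
  have hcI := S.cInner_pos
  have hA : 0 ≤ (1 - ρ) + β⁻¹ * cInner γ C ρ * c ^ (-ρ) := by positivity
  refine ⟨2 * ((1 - ρ) + β⁻¹ * cInner γ C ρ * c ^ (-ρ)), by positivity, fun g hg => ?_⟩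
  refine ⟨S.measurable_profileMap hg, S.profileMap_nonneg hg.nonneg, fun x hx => ?_,
    fun R hR => (S.profileMap_integral hg hR).1, fun R hR => ?_⟩
  · refine (S.profileMap_le hκ hc hc2 hg hx).trans ?_
    have hw := wt_pos (ρ := ρ) (κ := κ) hx
    gcongr
    nlinarith
  · rw [(S.profileMap_integral hg hR).2]
    exact S.cumulative_le hg hR.le

lemma subsingleton_tailJ_eq_one (hg : Adm ρ κ M g) :
    {x | 0 < x ∧ tailJ K ρ β g x = 1 ∧ Ifun K g x ≠ 0}.Subsingleton := by
  have key : ∀ a b : ℝ, 0 < a → a < b → tailJ K ρ β g a = 1 → tailJ K ρ β g b = 1 →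
      Ifun K g a = 0 := by
    intro a b ha hab h1 h2
    have hd := (S.hasDerivAt_tailJ hg ha).hasDerivWithinAt (s := Icc a b)
    have hd' : HasDerivWithinAt (tailJ K ρ β g) 0 (Icc a b) a := by
      refine (hasDerivWithinAt_const a (Icc a b) (1:ℝ)).congr (fun y hy => ?_) h1
      have hy0 : 0 < y := ha.trans_le hy.1
      refine le_antisymm ?_ ?_
      · rw [← h1]; exact S.tailJ_antitoneOn hg ha hy0 hy.1
      · rw [← h2]; exact S.tailJ_antitoneOn hg hy0 (ha.trans hab) hy.2
    have h3 := (uniqueDiffOn_Icc hab a ⟨le_rfl, hab.le⟩).eq_deriv _ hd hd'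
    have h4 := inv_pos.2 S.beta_pos
    have h5 := rpow_pos_of_pos ha (ρ - 2)
    simpa [h4.ne', h5.ne', S.beta_pos.ne'] using h3
  intro a ha b hb
  by_contra hne
  rcases lt_or_gt_of_ne hne with h | h
  · exact ha.2.2 (key a b ha.1 h ha.2.1 hb.2.1)
  · exact hb.2.2 (key b a hb.1 h hb.2.1 ha.2.1)

lemma tendsto_profileMap (hw : WeakLim ρ κ u g) (hu : ∀ n, Adm ρ κ M (u n)) (hg : Adm ρ κ M g) :
    ∀ᵐ x ∂volume.restrict (Ioi (0:ℝ)),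
      Tendsto (fun n => profileMap K ρ β (u n) x) atTop (𝓝 (profileMap K ρ β g x)) := by
  have hnull : ∀ᵐ x ∂volume.restrict (Ioi (0:ℝ)),
      x ∉ {x | 0 < x ∧ tailJ K ρ β g x = 1 ∧ Ifun K g x ≠ 0} :=
    ae_restrict_of_ae
      (measure_eq_zero_iff_ae_notMem.1 ((S.subsingleton_tailJ_eq_one hg).measure_zero volume))
  filter_upwards [hnull, ae_restrict_mem measurableSet_Ioi] with x hx hx0
  have hx0 : 0 < x := hx0
  have hJ := S.tendsto_tailJ hw hu hg hx0
  have hI := S.tendsto_Ifun hw hu hg (x := fun _ => x) tendsto_const_nhds hx0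
  have hf : Tendsto (fun n => flux K ρ β (u n) x) atTop (𝓝 (flux K ρ β g x)) :=
    (((hJ.const_sub 1).const_mul _).add (hI.const_mul _)).const_mul _
  rcases lt_trichotomy (tailJ K ρ β g x) 1 with h | h | h
  · rw [profileMap_of_lt hx0 h]
    refine hf.congr' ?_
    filter_upwards [hJ.eventually (gt_mem_nhds h)] with n hn
    rw [profileMap_of_lt hx0 hn]
  · have hI0 : Ifun K g x = 0 := by
      by_contra hne
      exact hx ⟨hx0, h, hne⟩
    have hf0 : flux K ρ β g x = 0 := by rw [flux, h, hI0]; ring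
    rw [profileMap_of_le h.ge]
    rw [hf0] at hf
    refine squeeze_zero_norm (fun n => ?_) (tendsto_norm_zero.comp hf)
    exact norm_indicator_le_norm_self _ _
  · rw [profileMap_of_le h.le]
    refine tendsto_const_nhds.congr' ?_
    filter_upwards [hJ.eventually (lt_mem_nhds h)] with n hn
    rw [profileMap_of_le hn.le]

end Setting
/-- Densities dominated by `M (x^{-ρ} + x^{-κ})`. -/
structure Dominated (ρ κ M : ℝ) (g : ℝ → ℝ) : Prop where
  meas : Measurable g
  nonneg : ∀ x, 0 ≤ g x
  le : ∀ x, 0 < x → g x ≤ M * wt ρ κ x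

lemma Adm.dominated (hg : Adm ρ κ M g) : Dominated ρ κ M g := ⟨hg.meas, hg.nonneg, hg.le⟩

/-- Lebesgue measure on the half line. -/
abbrev halfLine : Measure ℝ := volume.restrict (Ioi 0)

/-- A density divided by the weight, with an exponential cutoff. -/
def scaled (ρ κ : ℝ) (g : ℝ → ℝ) (x : ℝ) : ℝ := g x * (exp (-x) / wt ρ κ x)

open Classical in
/-- The element of `L²(0,∞)` defined by the rescaled density. -/
def emb (ρ κ : ℝ) (g : ℝ → ℝ) : Lp ℝ 2 halfLine :=
  if h : MemLp (scaled ρ κ g) 2 halfLine then h.toLp else 0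

lemma memLp_exp : MemLp (fun x => M * exp (-x)) 2 halfLine := by
  rw [memLp_two_iff_integrable_sq (by fun_prop)]
  have := (integrableOn_exp_mul_Ioi (a := -2) (by norm_num) 0).const_mul (M ^ 2)
  refine this.congr (Eventually.of_forall fun x => ?_)
  simp only [mul_pow, ← exp_nat_mul]
  congr 2
  push_cast; ring

namespace Dominated

lemma scaled_nonneg (hg : Dominated ρ κ M g) {x : ℝ} (hx : 0 < x) : 0 ≤ scaled ρ κ g x :=
  mul_nonneg (hg.nonneg x) (div_nonneg (exp_pos _).le (wt_pos hx).le)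

lemma scaled_le (hg : Dominated ρ κ M g) {x : ℝ} (hx : 0 < x) :
    scaled ρ κ g x ≤ M * exp (-x) := by
  have hw := wt_pos (ρ := ρ) (κ := κ) hx
  have h := hg.le x hx
  calc scaled ρ κ g x ≤ M * wt ρ κ x * (exp (-x) / wt ρ κ x) :=
        mul_le_mul_of_nonneg_right h (by positivity)
    _ = _ := by field_simp

lemma measurable_scaled (hg : Dominated ρ κ M g) : Measurable (scaled ρ κ g) :=
  hg.meas.mul (by have := measurable_wt (ρ := ρ) (κ := κ); fun_prop)

lemma ae_norm_scaled_le (hg : Dominated ρ κ M g) :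
    ∀ᵐ x ∂halfLine, ‖scaled ρ κ g x‖ ≤ M * exp (-x) := by
  filter_upwards [ae_restrict_mem measurableSet_Ioi] with x hx
  rw [norm_of_nonneg (hg.scaled_nonneg hx)]
  exact hg.scaled_le hx

lemma memLp (hg : Dominated ρ κ M g) : MemLp (scaled ρ κ g) 2 halfLine :=
  memLp_exp.mono' hg.measurable_scaled.aestronglyMeasurable hg.ae_norm_scaled_le

lemma coeFn_emb (hg : Dominated ρ κ M g) : emb ρ κ g =ᵐ[halfLine] scaled ρ κ g := by
  rw [emb, dif_pos hg.memLp]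
  exact hg.memLp.coeFn_toLp

lemma norm_emb_le (hg : Dominated ρ κ M g) :
    ‖emb ρ κ g‖ ≤ ‖(memLp_exp (M := M)).toLp‖ := by
  refine Lp.norm_le_norm_of_ae_le ?_
  filter_upwards [hg.coeFn_emb, (memLp_exp (M := M)).coeFn_toLp, hg.ae_norm_scaled_le]
    with x h1 h2 h3
  rw [h1, h2]
  exact h3.trans (le_abs_self _)

lemma inner_emb (hg : Dominated ρ κ M g) (v : Lp ℝ 2 halfLine) :
    inner ℝ v (emb ρ κ g) = ∫ x in Ioi 0, v x * scaled ρ κ g x := by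
  rw [L2.inner_def]
  refine integral_congr_ae ?_
  filter_upwards [hg.coeFn_emb] with x h1
  rw [h1]
  exact mul_comm _ _

lemma integrableOn_mul (hg : Dominated ρ κ M g) {φ : ℝ → ℝ} (hφ : Measurable φ)
    (hφw : IntegrableOn (fun x => φ x * wt ρ κ x) (Ioi 0)) :
    IntegrableOn (fun x => φ x * g x) (Ioi 0) := by
  refine Integrable.mono' (hφw.norm.const_mul M) (hφ.mul hg.meas).aestronglyMeasurable ?_
  filter_upwards [ae_restrict_mem measurableSet_Ioi] with x hx
  have hw := wt_pos (ρ := ρ) (κ := κ) hx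
  rw [norm_mul, norm_mul, norm_of_nonneg (hg.nonneg x), norm_of_nonneg hw.le, mul_left_comm]
  exact mul_le_mul_of_nonneg_left (hg.le x hx) (norm_nonneg _)

lemma abs_integral_sub_indicator_le (hg : Dominated ρ κ M g) {φ : ℝ → ℝ} (hφ : Measurable φ)
    (hφw : IntegrableOn (fun x => φ x * wt ρ κ x) (Ioi 0)) {s : Set ℝ} (hs : MeasurableSet s) :
    |(∫ x in Ioi 0, φ x * g x) - ∫ x in Ioi 0, s.indicator φ x * g x|
      ≤ ∫ x in Ioi 0, M * sᶜ.indicator (fun x => ‖φ x * wt ρ κ x‖) x := by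
  have h1 := hg.integrableOn_mul hφ hφw
  have h2 : IntegrableOn (fun x => s.indicator φ x * g x) (Ioi 0) := by
    refine (h1.indicator hs).congr (Eventually.of_forall fun x => ?_)
    exact indicator_mul_left _ _ _
  rw [← integral_sub h1 h2, ← Real.norm_eq_abs]
  refine norm_integral_le_of_norm_le ((hφw.norm.indicator hs.compl).const_mul M) ?_
  filter_upwards [ae_restrict_mem measurableSet_Ioi] with x hx
  have hw := wt_pos (ρ := ρ) (κ := κ) hx
  by_cases hxs : x ∈ s
  · simp [hxs]
  · rw [indicator_of_notMem hxs, indicator_of_mem (show x ∈ sᶜ from hxs), zero_mul, sub_zero,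
      norm_mul, norm_mul, norm_of_nonneg (hg.nonneg x), norm_of_nonneg hw.le, mul_left_comm]
    exact mul_le_mul_of_nonneg_left (hg.le x hx) (norm_nonneg _)

end Dominated

lemma weakLim_of_tendsto_inner (hu : ∀ n, Dominated ρ κ M (u n)) (hg : Dominated ρ κ M g)
    (h : ∀ v : Lp ℝ 2 halfLine,
      Tendsto (fun n => inner ℝ v (emb ρ κ (u n))) atTop (𝓝 (inner ℝ v (emb ρ κ g)))) :
    WeakLim ρ κ u g := by
  intro φ hφ hφw
  have hwm := measurable_wt (ρ := ρ) (κ := κ)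
  set F : ℝ → ℝ := fun x => φ x * wt ρ κ x * exp x with hF
  have hFm : Measurable F := by fun_prop
  set s : ℕ → Set ℝ := fun k => {x | |F x| ≤ k ∧ x ≤ k} with hs
  have hsm : ∀ k, MeasurableSet (s k) := fun k =>
    (measurableSet_le hFm.abs measurable_const).inter measurableSet_Iic
  have hmem : ∀ k, MemLp ((s k).indicator F) 2 halfLine := by
    intro k
    refine (memLp_indicator_const 2 (measurableSet_Iic (a := (k:ℝ))) (k:ℝ)
      (Or.inr ?_)).mono' (hFm.indicator (hsm k)).aestronglyMeasurable ?_
    · rw [Measure.restrict_apply measurableSet_Iic, inter_comm, Ioi_inter_Iic]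
      exact measure_Ioc_lt_top.ne
    · refine Eventually.of_forall fun x => ?_
      by_cases hx : x ∈ s k
      · rw [indicator_of_mem hx, indicator_of_mem (show x ∈ Iic (k:ℝ) from hx.2)]
        exact hx.1
      · rw [indicator_of_notMem hx, norm_zero]
        exact indicator_nonneg (fun _ _ => Nat.cast_nonneg k) _
  have key : ∀ k v, Dominated ρ κ M v → inner ℝ ((hmem k).toLp) (emb ρ κ v) =
      ∫ x in Ioi 0, (s k).indicator φ x * v x := by
    intro k v hv
    rw [hv.inner_emb]
    refine integral_congr_ae ?_
    filter_upwards [(hmem k).coeFn_toLp, ae_restrict_mem measurableSet_Ioi] with x h1 hx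
    have hw := wt_pos (ρ := ρ) (κ := κ) hx
    rw [h1]
    by_cases hxs : x ∈ s k
    · rw [indicator_of_mem hxs, indicator_of_mem hxs, scaled, hF, exp_neg]
      field_simp
    · rw [indicator_of_notMem hxs, indicator_of_notMem hxs, zero_mul, zero_mul]
  refine tendsto_of_approx (l := atTop (α := ℕ))
    (b := fun k n => ∫ x in Ioi 0, (s k).indicator φ x * u n x)
    (B := fun k => ∫ x in Ioi 0, (s k).indicator φ x * g x)
    (e := fun k => ∫ x in Ioi 0, M * (s k)ᶜ.indicator (fun x => ‖φ x * wt ρ κ x‖) x)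
    (Eventually.of_forall fun k => ?_)
    (Eventually.of_forall fun k => Eventually.of_forall fun n =>
      (hu n).abs_integral_sub_indicator_le hφ hφw (hsm k))
    (Eventually.of_forall fun k => hg.abs_integral_sub_indicator_le hφ hφw (hsm k)) ?_
  · have := h ((hmem k).toLp)
    simp_rw [key k _ (hu _), key k _ hg] at this
    exact this
  · suffices he : Tendsto (fun k => ∫ x in Ioi 0, M * (s k)ᶜ.indicator
        (fun x => ‖φ x * wt ρ κ x‖) x) atTop (𝓝 (∫ x in Ioi (0:ℝ), (0:ℝ))) by
      rwa [integral_zero] at he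
    refine tendsto_integral_of_dominated_convergence (fun x => |M| * ‖φ x * wt ρ κ x‖)
      (fun k => (((hφ.mul hwm).norm.indicator (hsm k).compl).const_mul M).aestronglyMeasurable)
      (hφw.norm.const_mul |M|) (fun k => Eventually.of_forall fun x => ?_)
      (Eventually.of_forall fun x => ?_)
    · rw [norm_mul]
      refine mul_le_mul_of_nonneg_left ?_ (abs_nonneg M)
      exact (norm_indicator_le_norm_self _ _).trans (norm_norm _).le
    · refine tendsto_const_nhds.congr' ?_
      obtain ⟨k, hk⟩ := exists_nat_ge (max |F x| x)
      filter_upwards [eventually_ge_atTop k] with j hj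
      have hkj : (k:ℝ) ≤ j := Nat.cast_le.2 hj
      have : x ∈ s j := ⟨(le_max_left _ _).trans (hk.trans hkj),
        (le_max_right _ _).trans (hk.trans hkj)⟩
      rw [indicator_of_notMem (by simpa using this), mul_zero]

lemma tendsto_emb (hu : ∀ n, Dominated ρ κ M (u n)) (hg : Dominated ρ κ M g)
    (h : ∀ᵐ x ∂halfLine, Tendsto (fun n => u n x) atTop (𝓝 (g x))) :
    Tendsto (fun n => emb ρ κ (u n)) atTop (𝓝 (emb ρ κ g)) := by
  rw [tendsto_iff_norm_sub_tendsto_zero]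
  have e : ∀ n, ‖emb ρ κ (u n) - emb ρ κ g‖ =
      √(∫ x in Ioi 0, (scaled ρ κ (u n) x - scaled ρ κ g x) ^ 2) := by
    intro n
    rw [@norm_eq_sqrt_real_inner, L2.inner_def]
    congr 1
    refine integral_congr_ae ?_
    filter_upwards [(hu n).coeFn_emb, hg.coeFn_emb, Lp.coeFn_sub (emb ρ κ (u n)) (emb ρ κ g)]
      with x h1 h2 h3
    rw [h3, Pi.sub_apply, h1, h2, sq]
    rfl
  simp_rw [e]
  suffices hsq : Tendsto (fun n => ∫ x in Ioi 0, (scaled ρ κ (u n) x - scaled ρ κ g x) ^ 2) atTop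
      (𝓝 (∫ x in Ioi (0:ℝ), (0:ℝ))) by
    rw [integral_zero] at hsq
    have := (continuous_sqrt.tendsto 0).comp hsq
    rwa [sqrt_zero] at this
  have hi := (memLp_two_iff_integrable_sq (memLp_exp (M := M)).1).1 memLp_exp
  refine tendsto_integral_of_dominated_convergence (fun x => (M * exp (-x)) ^ 2)
    (fun n => Measurable.aestronglyMeasurable (by
      have h1 := (hu n).measurable_scaled
      have h2 := hg.measurable_scaled
      fun_prop)) hi (fun n => ?_) ?_
  · filter_upwards [ae_restrict_mem measurableSet_Ioi] with x hx
    have h1 := (hu n).scaled_nonneg hx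
    have h2 := (hu n).scaled_le hx
    have h3 := hg.scaled_nonneg hx
    have h4 := hg.scaled_le hx
    rw [norm_of_nonneg (sq_nonneg _), sq_le_sq, abs_of_nonneg (h1.trans h2), abs_le]
    constructor <;> linarith
  · filter_upwards [h] with x hx
    have : Tendsto (fun n => (scaled ρ κ (u n) x - scaled ρ κ g x) ^ 2) atTop
        (𝓝 ((scaled ρ κ g x - scaled ρ κ g x) ^ 2)) :=
      ((hx.mul_const _).sub_const _).pow 2
    simpa using this

lemma exists_subseq_tendsto_inner {H : Type*} [NormedAddCommGroup H] [InnerProductSpace ℝ H]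
    [CompleteSpace H] [TopologicalSpace.SeparableSpace H] {v : ℕ → H} {r : ℝ}
    (hv : ∀ n, ‖v n‖ ≤ r) : ∃ (f : H) (φ : ℕ → ℕ), StrictMono φ ∧
      ∀ w : H, Tendsto (fun n => inner ℝ w (v (φ n))) atTop (𝓝 (inner ℝ w f)) := by
  obtain ⟨ξ, -, φ, hφ, hlim⟩ := WeakDual.isSeqCompact_closedBall ℝ H 0 r
    (x := fun n => StrongDual.toWeakDual (InnerProductSpace.toDual ℝ H (v n))) fun n => by
      have : ‖InnerProductSpace.toDual ℝ H (v n)‖ ≤ r := by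
        rw [LinearIsometryEquiv.norm_map]; exact hv n
      simpa using this
  refine ⟨(InnerProductSpace.toDual ℝ H).symm (WeakDual.toStrongDual ξ), φ, hφ, fun w => ?_⟩
  have h := ((WeakDual.eval_continuous w).tendsto ξ).comp hlim
  have e : inner ℝ w ((InnerProductSpace.toDual ℝ H).symm (WeakDual.toStrongDual ξ)) = ξ w := by
    rw [real_inner_comm, InnerProductSpace.toDual_symm_apply]
    rfl
  rw [e]
  refine h.congr fun n => ?_
  rw [real_inner_comm]
  rfl

lemma exists_dominated_emb_eq (hM : 0 ≤ M) (hu : ∀ n, Dominated ρ κ M (u n))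
    {f : Lp ℝ 2 halfLine}
    (hf : ∀ v, Tendsto (fun n => inner ℝ v (emb ρ κ (u n))) atTop (𝓝 (inner ℝ v f))) :
    ∃ g, Dominated ρ κ M g ∧ emb ρ κ g = f := by
  have hgint : ∀ n, ∀ s, MeasurableSet s → halfLine s < ⊤ →
      IntegrableOn (fun x => emb ρ κ (u n) x) s halfLine := fun n s _ hs =>
    integrableOn_Lp_of_measure_ne_top _ (by norm_num) hs.ne
  have hgintf : ∀ s, MeasurableSet s → halfLine s < ⊤ →
      IntegrableOn (fun x => f x) s halfLine := fun s _ hs =>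
    integrableOn_Lp_of_measure_ne_top _ (by norm_num) hs.ne
  have hexp : Integrable (fun x => M * exp (-x)) halfLine := by
    have := (integrableOn_exp_mul_Ioi (a := -1) (by norm_num) 0).const_mul M
    simpa using this
  have hlim : ∀ s, MeasurableSet s → halfLine s < ⊤ →
      Tendsto (fun n => ∫ x in s, emb ρ κ (u n) x ∂halfLine) atTop
        (𝓝 (∫ x in s, f x ∂halfLine)) := by
    intro s hs hμ
    have := hf (indicatorConstLp 2 hs hμ.ne 1)
    simpa only [L2.inner_indicatorConstLp_one] using this
  have h0 : 0 ≤ᵐ[halfLine] f := by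
    refine ae_nonneg_of_forall_setIntegral_nonneg_of_sigmaFinite hgintf fun s hs hμ => ?_
    refine ge_of_tendsto' (hlim s hs hμ) fun n => integral_nonneg_of_ae ?_
    filter_upwards [ae_restrict_of_ae (hu n).coeFn_emb,
      ae_restrict_of_ae (ae_restrict_mem measurableSet_Ioi)] with x h1 hx
    rw [h1]
    exact (hu n).scaled_nonneg hx
  have h1 : 0 ≤ᵐ[halfLine] fun x => M * exp (-x) - f x := by
    refine ae_nonneg_of_forall_setIntegral_nonneg_of_sigmaFinite
      (fun s hs hμ => hexp.integrableOn.sub (hgintf s hs hμ)) fun s hs hμ => ?_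
    rw [integral_sub hexp.integrableOn (hgintf s hs hμ), sub_nonneg]
    refine le_of_tendsto' (hlim s hs hμ) fun n => ?_
    refine integral_mono_ae (hgint n s hs hμ) hexp.integrableOn ?_
    filter_upwards [ae_restrict_of_ae (hu n).coeFn_emb,
      ae_restrict_of_ae (ae_restrict_mem measurableSet_Ioi)] with x h1 hx
    rw [h1]
    exact (hu n).scaled_le hx
  have hwm := measurable_wt (ρ := ρ) (κ := κ)
  have hfm : Measurable f := (Lp.stronglyMeasurable f).measurable
  set g : ℝ → ℝ := (Ioi 0).indicator fun x => max 0 (min M (f x * exp x)) * wt ρ κ x with hg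
  have hgd : Dominated ρ κ M g := by
    refine ⟨Measurable.indicator (by fun_prop) measurableSet_Ioi, fun x => ?_, fun x hx => ?_⟩
    · exact indicator_nonneg
        (fun x hx => mul_nonneg (le_max_left _ _) (wt_pos hx).le) x
    · rw [hg, indicator_of_mem (show x ∈ Ioi 0 from hx)]
      exact mul_le_mul_of_nonneg_right (max_le hM (min_le_left _ _)) (wt_pos hx).le
  refine ⟨g, hgd, Lp.ext ?_⟩
  filter_upwards [hgd.coeFn_emb, h0, h1, ae_restrict_mem measurableSet_Ioi] with x e h0 h1 hx
  have hw := wt_pos (ρ := ρ) (κ := κ) hx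
  have he := exp_pos x
  have h0 : 0 ≤ f x := h0
  have h1 : 0 ≤ M * exp (-x) - f x := h1
  have h2 : f x * exp x ≤ M := by
    have := mul_le_mul_of_nonneg_right (sub_nonneg.1 h1) he.le
    rwa [mul_assoc, ← exp_add, neg_add_cancel, exp_zero, mul_one] at this
  rw [e, scaled, hg, indicator_of_mem hx, min_eq_right h2, max_eq_right (by positivity), exp_neg]
  field_simp

lemma adm_of_weakLim (hu : ∀ n, Adm ρ κ M (u n)) (hg : Dominated ρ κ M g)
    (hw : WeakLim ρ κ u g) : Adm ρ κ M g := by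
  have hwm := measurable_wt (ρ := ρ) (κ := κ)
  have key : ∀ a R : ℝ, 0 < a → 0 < R →
      IntegrableOn g (Ioc a R) ∧ ∫ x in Ioc a R, g x ≤ R ^ (1 - ρ) := by
    intro a R ha hR
    have e : ∀ v : ℝ → ℝ, ∀ x, (Ioc a R).indicator (fun _ => (1:ℝ)) x * v x =
        (Ioc a R).indicator v x := fun v x => by
      rw [← indicator_mul_left]; simp
    have hsub : Ioc a R ⊆ Ioi 0 := fun x hx => ha.trans hx.1
    have hm : Measurable ((Ioc a R).indicator fun _ => (1:ℝ)) :=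
      measurable_const.indicator measurableSet_Ioc
    have hi : IntegrableOn (fun x => (Ioc a R).indicator (fun _ => (1:ℝ)) x * wt ρ κ x)
        (Ioi 0) := by
      simp_rw [e]
      have hc : IntegrableOn (wt ρ κ) (Icc a R) :=
        (continuousOn_wt.mono fun x hx => ha.trans_le hx.1).integrableOn_Icc
      rw [integrableOn_indicator_iff measurableSet_Ioc]
      exact hc.mono_set (inter_subset_left.trans Ioc_subset_Icc_self)
    have h1 := hg.integrableOn_mul hm hi
    have h2 := hw _ hm hi
    simp_rw [e] at h1 h2
    rw [integrableOn_indicator_iff measurableSet_Ioc, inter_eq_left.2 hsub] at h1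
    simp_rw [setIntegral_indicator measurableSet_Ioc, inter_eq_right.2 hsub] at h2
    refine ⟨h1, le_of_tendsto' h2 fun n => ?_⟩
    refine le_trans ?_ ((hu n).mass R hR)
    exact setIntegral_mono_set ((hu n).int R hR) (Eventually.of_forall (hu n).nonneg)
      (Ioc_subset_Ioc_left ha.le).eventuallyLE
  have hcov : ∀ R : ℝ, AECover (volume.restrict (Ioc 0 R)) atTop
      fun n : ℕ => Ioc (1 / ((n:ℝ) + 1)) R := fun R =>
    aecover_Ioc_of_Ioc tendsto_one_div_add_atTop_nhds_zero_nat tendsto_const_nhds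
  have hpos : ∀ n : ℕ, (0:ℝ) < 1 / ((n:ℝ) + 1) := fun n => by positivity
  have hres : ∀ (n : ℕ) (R : ℝ), (volume.restrict (Ioc 0 R)).restrict (Ioc (1 / ((n:ℝ) + 1)) R) =
      volume.restrict (Ioc (1 / ((n:ℝ) + 1)) R) := fun n R => by
    rw [Measure.restrict_restrict measurableSet_Ioc,
      inter_eq_left.2 (Ioc_subset_Ioc_left (hpos n).le)]
  have hgint : ∀ R, 0 < R → IntegrableOn g (Ioc 0 R) := by
    intro R hR
    refine (hcov R).integrable_of_integral_bounded_of_nonneg_ae (R ^ (1 - ρ)) (fun n => ?_)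
      (Eventually.of_forall hg.nonneg) (Eventually.of_forall fun n => ?_)
    · rw [IntegrableOn, hres]; exact (key _ R (hpos n) hR).1
    · rw [hres]; exact (key _ R (hpos n) hR).2
  refine ⟨hg.meas, hg.nonneg, hg.le, hgint, fun R hR => ?_⟩
  refine le_of_tendsto' ((hcov R).integral_tendsto_of_countably_generated (hgint R hR)) fun n => ?_
  rw [hres]; exact (key _ R (hpos n) hR).2

lemma exists_subseq_weakLim (hu : ∀ n, Adm ρ κ M (u n)) : ∃ (g : ℝ → ℝ) (φ : ℕ → ℕ),
    Adm ρ κ M g ∧ StrictMono φ ∧ ∀ v : Lp ℝ 2 halfLine,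
      Tendsto (fun n => inner ℝ v (emb ρ κ (u (φ n)))) atTop (𝓝 (inner ℝ v (emb ρ κ g))) := by
  have : Fact ((2:ENNReal) ≠ ⊤) := ⟨by norm_num⟩
  obtain ⟨f, φ, hφ, hlim⟩ := exists_subseq_tendsto_inner fun n => (hu n).dominated.norm_emb_le
  obtain ⟨g, hg, rfl⟩ := exists_dominated_emb_eq (hu 0).M_nonneg
    (fun n => (hu (φ n)).dominated) hlim
  exact ⟨g, φ, adm_of_weakLim (fun n => hu (φ n)) hg
    (weakLim_of_tendsto_inner (fun n => (hu (φ n)).dominated) hg hlim), hφ, hlim⟩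

lemma Adm.zero (hM : 0 ≤ M) : Adm ρ κ M fun _ => 0 :=
  ⟨measurable_const, fun _ => le_rfl, fun _ hx => mul_nonneg hM (wt_pos hx).le,
    fun _ _ => integrableOn_zero, fun R hR => by simpa using rpow_nonneg hR.le _⟩

lemma Adm.convexComb {g' : ℝ → ℝ} (hg : Adm ρ κ M g) (hg' : Adm ρ κ M g') {a b : ℝ} (ha : 0 ≤ a)
    (hb : 0 ≤ b) (hab : a + b = 1) : Adm ρ κ M fun x => a * g x + b * g' x := by
  have hi : ∀ R, 0 < R → IntegrableOn (fun x => a * g x) (Ioc 0 R) := fun R hR =>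
    (hg.int R hR).const_mul a
  have hi' : ∀ R, 0 < R → IntegrableOn (fun x => b * g' x) (Ioc 0 R) := fun R hR =>
    (hg'.int R hR).const_mul b
  refine ⟨(hg.meas.const_mul a).add (hg'.meas.const_mul b), fun x => ?_, fun x hx => ?_,
    fun R hR => (hi R hR).add (hi' R hR), fun R hR => ?_⟩
  · have := hg.nonneg x
    have := hg'.nonneg x
    positivity
  · calc _ ≤ a * (M * wt ρ κ x) + b * (M * wt ρ κ x) := by
          have := hg.le x hx
          have := hg'.le x hx
          gcongr
      _ = _ := by rw [← add_mul, hab, one_mul]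
  · rw [integral_add (hi R hR) (hi' R hR), integral_const_mul, integral_const_mul]
    calc _ ≤ a * R ^ (1 - ρ) + b * R ^ (1 - ρ) := by
          have := hg.mass R hR
          have := hg'.mass R hR
          gcongr
      _ = _ := by rw [← add_mul, hab, one_mul]

lemma convex_emb_image : Convex ℝ (emb ρ κ '' {g | Adm ρ κ M g}) := by
  rintro _ ⟨g, hg, rfl⟩ _ ⟨g', hg', rfl⟩ a b ha hb hab
  have hc := Adm.convexComb hg hg' ha hb hab
  refine ⟨_, hc, Lp.ext ?_⟩
  filter_upwards [hc.dominated.coeFn_emb, (Adm.dominated hg).coeFn_emb,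
    (Adm.dominated hg').coeFn_emb, Lp.coeFn_add (a • emb ρ κ g) (b • emb ρ κ g'),
    Lp.coeFn_smul a (emb ρ κ g), Lp.coeFn_smul b (emb ρ κ g')] with x h1 h2 h3 h4 h5 h6
  rw [h1, h4, Pi.add_apply, h5, h6, Pi.smul_apply, Pi.smul_apply, h2, h3]
  simp only [scaled, smul_eq_mul]
  ring

lemma Ifun_congr {g' : ℝ → ℝ} (h : ∀ᵐ x ∂halfLine, g x = g' x) (x : ℝ) :
    Ifun K g x = Ifun K g' x := by
  refine setIntegral_congr_ae measurableSet_Ioc ?_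
  have h' := (ae_restrict_iff' measurableSet_Ioi).1 h
  filter_upwards [h'] with y hy hyx
  rw [hy hyx.1]
  congr 1
  refine setIntegral_congr_ae measurableSet_Ioi ?_
  filter_upwards [h'] with z hz hzx
  rw [hz (lt_of_le_of_lt (sub_nonneg.2 hyx.2) hzx)]

lemma profileMap_congr {g' : ℝ → ℝ} (h : ∀ᵐ x ∂halfLine, g x = g' x) :
    profileMap K ρ β g = profileMap K ρ β g' := by
  have hI : Ifun K g = Ifun K g' := funext (Ifun_congr h)
  have hF : flux K ρ β g = flux K ρ β g' := funext fun x => by simp only [flux, tailJ, hI]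
  simp only [profileMap, tailJ, hI, hF]

lemma exists_profileMap_eq (S : Setting K γ C ρ β κ) (hκ : κ = ρ + ρ * ((1 - γ) / (1 - ρ))) :
    ∃ M h, Adm ρ κ M h ∧ profileMap K ρ β h = h := by
  classical
  obtain ⟨M, hM, hmap⟩ := S.exists_adm_profileMap hκ
  set Y : Set (Lp ℝ 2 halfLine) := emb ρ κ '' {g | Adm ρ κ M g} with hY
  choose! G hG hGe using fun (f : Lp ℝ 2 halfLine) (hf : f ∈ Y) => hf
  have hG : ∀ f ∈ Y, Adm ρ κ M (G f) := hG
  set T : Lp ℝ 2 halfLine → Lp ℝ 2 halfLine := fun f => emb ρ κ (profileMap K ρ β (G f)) with hT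
  have hTlim : ∀ (v : ℕ → Lp ℝ 2 halfLine) (f : Lp ℝ 2 halfLine), (∀ n, v n ∈ Y) → f ∈ Y →
      (∀ w, Tendsto (fun n => inner ℝ w (v n)) atTop (𝓝 (inner ℝ w f))) →
      Tendsto (fun n => T (v n)) atTop (𝓝 (T f)) := by
    intro v f hv hf hlim
    refine tendsto_emb (M := M) (fun n => (hmap _ (hG _ (hv n))).dominated)
      (hmap _ (hG f hf)).dominated ?_
    refine S.tendsto_profileMap (M := M) ?_ (fun n => hG _ (hv n)) (hG f hf)
    refine weakLim_of_tendsto_inner (fun n => (hG _ (hv n)).dominated) (hG f hf).dominated ?_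
    intro w
    rw [hGe f hf]
    exact (hlim w).congr fun n => by rw [hGe _ (hv n)]
  have hTY : T '' Y ⊆ Y := by
    rintro _ ⟨f, hf, rfl⟩
    exact ⟨_, hmap _ (hG f hf), rfl⟩
  have hcont : ContinuousOn T Y := by
    rw [continuousOn_iff_continuous_domRestrict]
    refine SeqContinuous.continuous fun v f hv => ?_
    refine hTlim (fun n => v n) f (fun n => (v n).2) f.2 fun w => ?_
    exact ((continuous_const.inner continuous_subtype_val).tendsto f).comp hv
  have hcomp : IsCompact (T '' Y) := by
    refine IsSeqCompact.isCompact fun v hv => ?_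
    choose f hf hfv using hv
    obtain ⟨g, φ, hg, hφ, hlim⟩ := exists_subseq_weakLim fun n => hG _ (hf n)
    have hgY : emb ρ κ g ∈ Y := ⟨g, hg, rfl⟩
    refine ⟨_, ⟨_, hgY, rfl⟩, φ, hφ, ?_⟩
    have := hTlim (fun n => f (φ n)) _ (fun n => hf _) hgY fun w => by
      simpa only [hGe _ (hf _)] using hlim w
    exact this.congr fun n => hfv _
  obtain ⟨f, hf, hfix⟩ := exists_fixedPoint_of_mapsTo_compact
    (show Y.Nonempty from ⟨_, _, Adm.zero hM, rfl⟩) convex_emb_image hcomp hTY hcont (mapsTo_image T Y)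
  have hh := hmap _ (hG f hf)
  refine ⟨M, _, hh, profileMap_congr ?_⟩
  have hf1 := (hG f hf).dominated.coeFn_emb
  rw [hGe f hf, ← hfix] at hf1
  filter_upwards [hf1, hh.dominated.coeFn_emb, ae_restrict_mem measurableSet_Ioi] with x h1 h2 hx
  rw [h2] at h1
  have hw := wt_pos (ρ := ρ) (κ := κ) hx
  have : exp (-x) / wt ρ κ x ≠ 0 := by positivity
  exact mul_right_cancel₀ this (by simpa only [scaled, hfix] using h1)

variable {h : ℝ → ℝ}
namespace Setting
variable (S : Setting K γ C ρ β κ)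
include S

lemma exists_tailJ_eq_one (hh : Adm ρ κ M h) {x₁ : ℝ} (hx₁ : 0 < x₁)
    (hJ : 1 ≤ tailJ K ρ β h x₁) : ∃ x₀, 0 < x₀ ∧ tailJ K ρ β h x₀ = 1 ∧
      ∀ x, x₀ < x → tailJ K ρ β h x < 1 := by
  obtain ⟨b, hb, hbx⟩ := ((S.tendsto_tailJ_atTop hh).eventually (gt_mem_nhds one_pos)).and
    (eventually_ge_atTop x₁) |>.exists
  have hcont := S.continuousOn_tailJ hh
  obtain ⟨x₀, hx₀, hJ₀⟩ := intermediate_value_Icc' hbx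
    (hcont.mono fun x hx => hx₁.trans_le hx.1) ⟨hb.le, hJ⟩
  have hcl : IsCompact (Icc x₁ b ∩ tailJ K ρ β h ⁻¹' {1}) :=
    isCompact_Icc.of_isClosed_subset ((hcont.mono
      fun x hx => hx₁.trans_le hx.1).preimage_isClosed_of_isClosed isClosed_Icc isClosed_singleton)
      inter_subset_left
  obtain ⟨a, ⟨⟨ha1, hab⟩, hJa⟩, hmax⟩ := hcl.exists_isGreatest ⟨x₀, hx₀, hJ₀⟩
  have ha0 : 0 < a := hx₁.trans_le ha1
  refine ⟨a, ha0, hJa, fun x hx => ?_⟩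
  have hx0 : 0 < x := ha0.trans hx
  refine lt_of_le_of_ne ((S.tailJ_antitoneOn hh ha0 hx0 hx.le).trans (le_of_eq hJa)) fun hJx => ?_
  rcases le_total x b with hxb | hxb
  · exact hx.not_ge (hmax ⟨⟨ha1.trans hx.le, hxb⟩, hJx⟩)
  · exact absurd (S.tailJ_antitoneOn hh (hx₁.trans_le hbx) hx0 hxb) (by rw [hJx]; exact hb.not_ge)

lemma Ifun_le_of_eq_zero (hh : Adm ρ κ M h) {x₀ x η s : ℝ} (hx₀ : 0 < x₀) (hs0 : 0 ≤ s)
    (hη : η ≤ 1) (hzero : ∀ y ∈ Ioc 0 x₀, h y = 0) (hs : ∀ y ∈ Ioc x₀ (x₀ + η), h y ≤ s)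
    (hx : x ∈ Ioc x₀ (x₀ + η)) :
    Ifun K h x ≤ cInner γ C ρ * (x₀ + 1) ^ γ / (1 - ρ) * η ^ (1 - ρ) * s := by
  have h1 := S.Ifun_le_of_le hh (x := x) (θ := x - x₀) (s := s) (sub_pos.2 hx.1) (by linarith)
    fun y hy => hs y ⟨by linarith [hy.1], hy.2.trans hx.2⟩
  rw [sub_sub_cancel, setIntegral_congr_fun measurableSet_Ioc hzero, integral_zero, mul_zero,
    zero_add] at h1
  have hρ : 0 < 1 - ρ := by linarith [S.rho_lt]
  have hc := S.cInner_pos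
  have hx0 : 0 < x := hx₀.trans hx.1
  have hθ : 0 ≤ x - x₀ := by linarith [hx.1]
  have h2 : x ^ γ ≤ (x₀ + 1) ^ γ :=
    rpow_le_rpow hx0.le (by linarith [hx.2]) S.gamma_nonneg
  have h3 : (x - x₀) ^ (1 - ρ) ≤ η ^ (1 - ρ) :=
    rpow_le_rpow hθ (by linarith [hx.2]) hρ.le
  calc _ ≤ _ := h1
    _ ≤ cInner γ C ρ * (x₀ + 1) ^ γ * (s * (η ^ (1 - ρ) / (1 - ρ))) := by gcongr
    _ = _ := by ring

lemma one_sub_tailJ_le (hh : Adm ρ κ M h) {x₀ x η B : ℝ} (hx₀ : 0 < x₀) (hη : η ≤ 1)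
    (hJ : tailJ K ρ β h x₀ = 1) (hB : ∀ y ∈ Ioc x₀ (x₀ + η), Ifun K h y ≤ B)
    (hx : x ∈ Ioc x₀ (x₀ + η)) :
    1 - tailJ K ρ β h x ≤ β⁻¹ * x₀ ^ (ρ - 2) * B := by
  have hβ := S.beta_pos
  have hB0 : 0 ≤ B := (S.Ifun_nonneg hh.nonneg x).trans (hB x hx)
  rw [S.tailJ_eq_sub hh hx₀ hx.1.le, hJ, sub_sub_cancel, mul_assoc]
  refine mul_le_mul_of_nonneg_left ?_ (inv_nonneg.2 hβ.le)
  have h1 := intervalIntegral.norm_integral_le_of_norm_le_const (a := x₀) (b := x)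
    (f := fun s => Ifun K h s * s ^ (ρ - 2)) (C := x₀ ^ (ρ - 2) * B) fun y hy => by
      rw [uIoc_of_le hx.1.le] at hy
      have hy0 : 0 < y := hx₀.trans hy.1
      rw [norm_of_nonneg (S.Ifun_mul_rpow_nonneg hh hy0), mul_comm]
      exact mul_le_mul (rpow_le_rpow_of_nonpos hx₀ hy.1.le (by linarith [S.rho_lt]))
        (hB y ⟨hy.1, hy.2.trans hx.2⟩) (S.Ifun_nonneg hh.nonneg y) (rpow_nonneg hx₀.le _)
  refine (le_abs_self _).trans (h1.trans ?_)
  rw [abs_of_nonneg (by linarith [hx.1])]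
  exact mul_le_of_le_one_right (mul_nonneg (rpow_nonneg hx₀.le _) hB0) (by linarith [hx.2])

lemma tailJ_lt_one (hh : Adm ρ κ M h) (hfix : profileMap K ρ β h = h) {x : ℝ} (hx : 0 < x) :
    tailJ K ρ β h x < 1 := by
  by_contra hJ
  obtain ⟨x₀, hx₀, hJ₀, hlt⟩ := S.exists_tailJ_eq_one hh hx (not_lt.1 hJ)
  have hβ := S.beta_pos
  have hρ : 0 < 1 - ρ := by linarith [S.rho_lt]
  have hzero : ∀ y ∈ Ioc 0 x₀, h y = 0 := by
    intro y hy
    rw [← hfix]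
    exact profileMap_of_le (hJ₀.symm.le.trans (S.tailJ_antitoneOn hh hy.1 hx₀ hy.2))
  set D := cInner γ C ρ * (x₀ + 1) ^ γ / (1 - ρ) with hD
  have hD0 : 0 ≤ D := by have := S.cInner_pos; positivity
  set E := x₀⁻¹ * ((1 - ρ) * (x₀ + 1) ^ (1 - ρ) * (β⁻¹ * x₀ ^ (ρ - 2) * D) + β⁻¹ * D) with hE
  obtain ⟨η, hη, hη2, hηE⟩ := exists_pos_mul_rpow_le S.rho_lt E
  have hη1 : η ≤ 1 := by linarith
  have hstep : ∀ s, 0 ≤ s → (∀ y ∈ Ioc x₀ (x₀ + η), h y ≤ s) →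
      ∀ y ∈ Ioc x₀ (x₀ + η), h y ≤ s * (1 / 2) := by
    intro s hs0 hs y hy
    have hI : ∀ y ∈ Ioc x₀ (x₀ + η), Ifun K h y ≤ D * η ^ (1 - ρ) * s := fun y hy =>
      S.Ifun_le_of_eq_zero hh hx₀ hs0 hη1 hzero hs hy
    have hJy := S.one_sub_tailJ_le hh hx₀ hη1 hJ₀ hI hy
    have hIy := hI y hy
    have hI0 := S.Ifun_nonneg hh.nonneg (K := K) y
    have hJ1 : 0 ≤ 1 - tailJ K ρ β h y := by linarith [hlt y hy.1]
    have hy0 : 0 < y := hx₀.trans hy.1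
    have hy1 : y ≤ x₀ + 1 := by linarith [hy.2]
    have hyx : y⁻¹ ≤ x₀⁻¹ := inv_anti₀ hx₀ hy.1.le
    rw [← hfix, profileMap_of_lt hy0 (hlt y hy.1), flux]
    calc _ ≤ x₀⁻¹ * ((1 - ρ) * (x₀ + 1) ^ (1 - ρ) * (β⁻¹ * x₀ ^ (ρ - 2) *
          (D * η ^ (1 - ρ) * s)) + β⁻¹ * (D * η ^ (1 - ρ) * s)) := by gcongr
      _ = E * η ^ (1 - ρ) * s := by rw [hE]; ring
      _ ≤ 1 / 2 * s := by gcongr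
      _ = _ := mul_comm _ _
  have hbd : ∀ n : ℕ, ∀ y ∈ Ioc x₀ (x₀ + η), h y ≤ M * wt ρ κ x₀ * (1 / 2) ^ n := by
    have hB0 : 0 ≤ M * wt ρ κ x₀ := mul_nonneg hh.M_nonneg (wt_pos hx₀).le
    intro n
    induction n with
    | zero =>
      intro y hy
      rw [pow_zero, mul_one]
      exact (hh.le y (hx₀.trans hy.1)).trans (mul_le_mul_of_nonneg_left
        (wt_anti S.rho_pos.le S.kappa_pos.le hx₀ hy.1.le) hh.M_nonneg)
    | succ n ih =>
      rw [pow_succ, ← mul_assoc]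
      exact hstep _ (by positivity) ih
  have hlim : Tendsto (fun n : ℕ => M * wt ρ κ x₀ * (1 / 2 : ℝ) ^ n) atTop (𝓝 0) := by
    have := (tendsto_pow_atTop_nhds_zero_of_lt_one (r := (1 / 2 : ℝ)) (by norm_num)
      (by norm_num)).const_mul (M * wt ρ κ x₀)
    rwa [mul_zero] at this
  have h0 : ∀ y ∈ Ioc x₀ (x₀ + η), h y ≤ 0 := fun y hy =>
    ge_of_tendsto' hlim fun n => hbd n y hy
  have hmem : x₀ + η ∈ Ioc x₀ (x₀ + η) := ⟨by linarith, le_rfl⟩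
  have := S.one_sub_tailJ_le hh hx₀ hη1 hJ₀
    (fun y hy => S.Ifun_le_of_eq_zero hh hx₀ le_rfl hη1 hzero h0 hy) hmem
  rw [mul_zero, mul_zero] at this
  linarith [hlt _ hmem.1]

lemma eq_flux (hh : Adm ρ κ M h) (hfix : profileMap K ρ β h = h) {x : ℝ} (hx : 0 < x) :
    h x = flux K ρ β h x := by
  conv_lhs => rw [← hfix]
  exact profileMap_of_lt hx (S.tailJ_lt_one hh hfix hx)

lemma continuousOn_of_profileMap_eq (hh : Adm ρ κ M h) (hfix : profileMap K ρ β h = h) :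
    ContinuousOn h (Ioi 0) :=
  (S.continuousOn_flux hh).congr fun _ hx => S.eq_flux hh hfix hx

lemma Ifun_eq_of_profileMap_eq (hh : Adm ρ κ M h) (hfix : profileMap K ρ β h = h) {x : ℝ}
    (hx : 0 < x) : Ifun K h x = β * x * h x - β * (1 - ρ) * cumulative K ρ β h x := by
  have hβ := S.beta_pos
  have hJ := S.tailJ_lt_one hh hfix hx
  rw [S.eq_flux hh hfix hx, flux, cumulative, max_eq_right (by linarith)]
  field_simp
  ring

lemma weak_form (hh : Adm ρ κ M h) (hfix : profileMap K ρ β h = h) {ψ : ℝ → ℝ}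
    (hψ : ContDiff ℝ 1 ψ) (hsupp : HasCompactSupport ψ) :
    (∫ x in Ioi (0:ℝ), deriv ψ x * Ifun K h x)
      - β * (∫ x in Ioi (0:ℝ), deriv (fun w => w * ψ w) x * h x)
      + β * ρ * (∫ x in Ioi (0:ℝ), ψ x * h x) = 0 := by
  have hρ : 0 < 1 - ρ := by linarith [S.rho_lt]
  obtain ⟨b, hb⟩ := hsupp.isCompact.bddAbove
  set R := max b 0 + 1 with hR
  have hR0 : 0 < R := by have := le_max_right b 0; linarith
  have hbR : b < R := by have := le_max_left b 0; linarith
  have hts : ∀ x, R ≤ x → x ∉ tsupport ψ := fun x hx hxs =>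
    (hbR.trans_le hx).not_ge (hb hxs)
  have hψ0 : ∀ x, R ≤ x → ψ x = 0 := fun x hx => image_eq_zero_of_notMem_tsupport (hts x hx)
  have hψ1 : ∀ x, R ≤ x → deriv ψ x = 0 := fun x hx =>
    Function.notMem_support.1 fun hxs => hts x hx (support_deriv_subset hxs)
  have hψd : ∀ x, HasDerivAt ψ (deriv ψ x) x := fun x =>
    (hψ.differentiable one_ne_zero x).hasDerivAt
  have hψc' : Continuous (deriv ψ) := hψ.continuous_deriv le_rfl
  have hd : ∀ x, deriv (fun w => w * ψ w) x = ψ x + x * deriv ψ x := fun x => by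
    have : HasDerivAt (fun w => w * ψ w) (1 * ψ x + x * deriv ψ x) x :=
      (hasDerivAt_id x).mul (hψd x)
    rw [this.deriv, one_mul]
  have hred : ∀ f : ℝ → ℝ, (∀ x, R ≤ x → f x = 0) → ∫ x in Ioi 0, f x = ∫ x in Ioc 0 R, f x := by
    intro f hf
    refine setIntegral_eq_of_subset_of_forall_sdiff_eq_zero measurableSet_Ioi
      Ioc_subset_Ioi_self fun x hx => hf x ?_
    by_contra hxR
    exact hx.2 ⟨hx.1, (not_le.1 hxR).le⟩
  have hgint : ∀ f : ℝ → ℝ, Continuous f → IntegrableOn (fun x => f x * h x) (Ioc 0 R) := by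
    intro f hf
    have h1 : IntegrableOn h (Icc 0 R) := (integrableOn_Icc_iff_integrableOn_Ioc).2 (hh.int R hR0)
    exact (h1.continuousOn_mul hf.continuousOn isCompact_Icc).mono_set Ioc_subset_Icc_self
  have hVc : ContinuousOn (cumulative K ρ β h) (Icc 0 R) :=
    (S.continuousOn_cumulative hh).mono fun x hx => hx.1
  have iV : IntegrableOn (fun x => deriv ψ x * cumulative K ρ β h x) (Ioc 0 R) :=
    (hψc'.continuousOn.mul hVc).integrableOn_Icc.mono_set Ioc_subset_Icc_self
  have i1 := hgint ψ hψ.continuous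
  have i2 := hgint (fun x => x * deriv ψ x) (continuous_id.mul hψc')
  have hparts : (∫ x in Ioc 0 R, deriv ψ x * cumulative K ρ β h x)
      + ∫ x in Ioc 0 R, ψ x * h x = 0 := by
    rw [← integral_add iV i1, ← intervalIntegral.integral_of_le hR0.le,
      intervalIntegral.integral_eq_sub_of_hasDerivAt_of_le hR0.le
        (f := fun x => ψ x * cumulative K ρ β h x)
        (f' := fun x => deriv ψ x * cumulative K ρ β h x + ψ x * h x) (hψ.continuous.continuousOn.mul hVc)
        (fun x hx => ?_)
        ((intervalIntegrable_iff_integrableOn_Ioc_of_le hR0.le).2 (iV.add i1))]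
    · simp [hψ0 R le_rfl, cumulative, zero_rpow hρ.ne']
    · have := S.hasDerivAt_cumulative hh hx.1 (S.tailJ_lt_one hh hfix hx.1)
      rw [← S.eq_flux hh hfix hx.1] at this
      exact (hψd x).mul this
  rw [hred _ fun x hx => by rw [hψ1 x hx, zero_mul],
    hred _ fun x hx => by rw [hd, hψ0 x hx, hψ1 x hx, mul_zero, add_zero, zero_mul],
    hred _ fun x hx => by rw [hψ0 x hx, zero_mul]]
  have e1 : ∫ x in Ioc 0 R, deriv ψ x * Ifun K h x =
      β * (∫ x in Ioc 0 R, x * deriv ψ x * h x)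
        - β * (1 - ρ) * ∫ x in Ioc 0 R, deriv ψ x * cumulative K ρ β h x := by
    rw [← integral_const_mul, ← integral_const_mul,
      ← integral_sub (i2.const_mul β) (iV.const_mul (β * (1 - ρ)))]
    refine setIntegral_congr_fun measurableSet_Ioc fun x hx => ?_
    rw [S.Ifun_eq_of_profileMap_eq hh hfix hx.1]
    ring
  have e2 : ∫ x in Ioc 0 R, deriv (fun w => w * ψ w) x * h x =
      (∫ x in Ioc 0 R, ψ x * h x) + ∫ x in Ioc 0 R, x * deriv ψ x * h x := by
    rw [← integral_add i1 i2]
    refine setIntegral_congr_fun measurableSet_Ioc fun x hx => ?_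
    rw [hd, add_mul]
  rw [e1, e2]
  linear_combination (-(β * (1 - ρ))) * hparts

lemma tendsto_div_rpow (hh : Adm ρ κ M h) (hfix : profileMap K ρ β h = h) :
    Tendsto (fun x => h x / ((1 - ρ) * x ^ (-ρ))) atTop (𝓝 1) := by
  have hρ : 0 < 1 - ρ := by linarith [S.rho_lt]
  have hβ := S.beta_pos
  have hγρ := S.gamma_lt
  have hκ := S.rho_le
  have hI : Tendsto (fun x => x ^ (ρ - 1) * Ifun K h x) atTop (𝓝 0) := by
    have hlim : Tendsto (fun x : ℝ => cOuter γ C ρ κ M * (x ^ (-(ρ - γ)) + x ^ (-(κ - γ))))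
        atTop (𝓝 0) := by
      have := ((tendsto_rpow_neg_atTop (y := ρ - γ) (by linarith)).add
        (tendsto_rpow_neg_atTop (y := κ - γ) (by linarith))).const_mul (cOuter γ C ρ κ M)
      simpa using this
    refine squeeze_zero' ?_ ?_ hlim
    · filter_upwards [eventually_ge_atTop 0] with x hx
      exact mul_nonneg (rpow_nonneg hx _) (S.Ifun_nonneg hh.nonneg x)
    · filter_upwards [eventually_gt_atTop 0] with x hx
      have h1 := mul_le_mul_of_nonneg_left (S.Ifun_le_wt hh hx) (rpow_nonneg hx.le (ρ - 1))
      have e1 : x ^ (ρ - 1) * x ^ (1 + γ - ρ) = x ^ γ := by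
        rw [← rpow_add hx]; congr 1; ring
      have e2 : x ^ (-(ρ - γ)) = x ^ γ * x ^ (-ρ) := by rw [← rpow_add hx]; congr 1; ring
      have e3 : x ^ (-(κ - γ)) = x ^ γ * x ^ (-κ) := by rw [← rpow_add hx]; congr 1; ring
      refine h1.trans (le_of_eq ?_)
      rw [e2, e3, ← e1, wt]
      ring
  have hlim := ((S.tendsto_tailJ_atTop hh).const_sub 1).add (hI.const_mul (β⁻¹ / (1 - ρ)))
  rw [sub_zero, mul_zero, add_zero] at hlim
  refine hlim.congr' ?_
  filter_upwards [eventually_gt_atTop 0] with x hx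
  have e1 : x⁻¹ * x ^ (1 - ρ) = x ^ (-ρ) := by
    rw [← rpow_neg_one, ← rpow_add hx]; congr 1; ring
  have e2 : x⁻¹ = x ^ (-ρ) * x ^ (ρ - 1) := by
    rw [← rpow_neg_one, ← rpow_add hx]; congr 1; ring
  have h1 : x ^ (-ρ) ≠ 0 := (rpow_pos_of_pos hx _).ne'
  rw [S.eq_flux hh hfix hx, flux, eq_div_iff (mul_ne_zero hρ.ne' h1)]
  have e3 : β⁻¹ / (1 - ρ) * (x ^ (ρ - 1) * Ifun K h x) * ((1 - ρ) * x ^ (-ρ)) =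
      β⁻¹ * (x ^ (-ρ) * x ^ (ρ - 1)) * Ifun K h x := by
    field_simp
  rw [add_mul, e3, ← e2, ← e1]
  ring

end Setting

lemma KernelHyp.setting (hK : KernelHyp K γ C) (hγ : 0 ≤ γ) (hC : 0 < C) (hρ : ρ ∈ Ioo γ 1)
    (hβ : 0 < β) (hκ : ρ ≤ κ) :
    Setting (fun y z => (Ioi (0:ℝ) ×ˢ Ioi (0:ℝ)).indicator (fun p => K p.1 p.2) (y, z))
      γ C ρ β κ := by
  classical
  refine ⟨hγ, hρ.1, hρ.2, hβ, hC, hκ, ?_, fun y z => ?_, fun y z hy hz => ?_⟩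
  · have := hK.cont.measurable_piecewise (g := fun _ => (0:ℝ)) continuousOn_const
      (measurableSet_Ioi.prod measurableSet_Ioi)
    have e := piecewise_eq_indicator (s := Ioi (0:ℝ) ×ˢ Ioi (0:ℝ))
      (f := fun p : ℝ × ℝ => K p.1 p.2)
    exact e ▸ this
  · exact indicator_nonneg (fun p hp => hK.nonneg _ _ hp.1 hp.2) _
  · rw [indicator_of_mem (show (y, z) ∈ Ioi (0:ℝ) ×ˢ Ioi (0:ℝ) from ⟨hy, hz⟩)]
    exact hK.growth y z hy hz

lemma Ifun_indicator (h : ℝ → ℝ) : Ifun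
    (fun y z => (Ioi (0:ℝ) ×ˢ Ioi (0:ℝ)).indicator (fun p => K p.1 p.2) (y, z)) h = Ifun K h := by
  funext x
  refine setIntegral_congr_fun measurableSet_Ioc fun y hy => ?_
  congr 1
  refine setIntegral_congr_fun measurableSet_Ioi fun z hz => ?_
  simp only
  rw [indicator_of_mem (show (y, z) ∈ Ioi (0:ℝ) ×ˢ Ioi (0:ℝ) from
    ⟨hy.1, lt_of_le_of_lt (sub_nonneg.2 hy.2) hz⟩)]

end Coagulation

/-- Existence of a fat-tail self-similar profile: there is a nonnegative continuous weak
stationary solution `h` with `∫_0^R h ≤ R^{1-ρ}` and `h(x) ~ (1-ρ)x^{-ρ}` as `x → ∞`. -/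
theorem existence_of_fat_tail_selfsimilar_profile
    (γ C ρ β : ℝ) (K : ℝ → ℝ → ℝ)
    (hγ : γ ∈ Ico (0:ℝ) 1) (hC : 0 < C) (hK : KernelHyp K γ C)
    (hρ : ρ ∈ Ioo γ 1) (hβ : β = 1 / (ρ - γ)) :
    ∃ h : ℝ → ℝ,
      ContinuousOn h (Ioi 0) ∧
      (∀ x ∈ Ioi (0:ℝ), 0 ≤ h x) ∧
      (∀ R > (0:ℝ), IntegrableOn h (Ioc 0 R)) ∧
      (∀ R > (0:ℝ), ∫ x in Ioc (0:ℝ) R, h x ≤ R ^ (1 - ρ)) ∧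
      (∀ ψ : ℝ → ℝ, ContDiff ℝ 1 ψ → HasCompactSupport ψ →
        (∫ x in Ioi (0:ℝ), deriv ψ x * Ifun K h x)
          - β * (∫ x in Ioi (0:ℝ), deriv (fun w => w * ψ w) x * h x)
          + β * ρ * (∫ x in Ioi (0:ℝ), ψ x * h x) = 0) ∧
      Tendsto (fun x => h x / ((1 - ρ) * x ^ (-ρ))) atTop (𝓝 1) := by
  have hβ0 : 0 < β := by
    rw [hβ]; exact one_div_pos.2 (sub_pos.2 hρ.1)
  have hρ0 : 0 ≤ ρ := hγ.1.trans hρ.1.le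
  have hκ : ρ ≤ ρ + ρ * ((1 - γ) / (1 - ρ)) :=
    le_add_of_nonneg_right (mul_nonneg hρ0 (div_nonneg (by linarith [hγ.2]) (by linarith [hρ.2])))
  have S := hK.setting hγ.1 hC hρ hβ0 hκ
  obtain ⟨M, h, hh, hfix⟩ := exists_profileMap_eq S rfl
  refine ⟨h, S.continuousOn_of_profileMap_eq hh hfix, fun x _ => hh.nonneg x, hh.int, hh.mass,
    fun ψ hψ hsupp => ?_, S.tendsto_div_rpow hh hfix⟩
  have := S.weak_form hh hfix hψ hsupp
  rwa [Ifun_indicator] at this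

end Smol
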